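/- arXiv:2409.20321 — 2 statements merged into one kernel-verified Lean document; each statement's English description precedes it below -/
import Mathlib

section
/- Let p, q ∈ C¹([0,ℓ];ℝ) and a ∈ C²([0,ℓ];ℝ) with a(x) > 0 on [0,ℓ]. Then there exists a unique K ∈ C²(closure Ω; ℝ) satisfying the Goursat problem: a(x)∂_x²K(x,y) − ∂_y²(a(y)K(x,y)) = (q(x) − p(y))K(x,y) for all (x,y) ∈ Ω; a(0)∂_yK(x,0) + a'(0)K(x,0) = 0 for 0 < x < ℓ; 2a(x)(d/dx)[K(x,x)] + a'(x)K(x,x) = q(x) − p(x) for 0 < x < ℓ; and K(0,0) = 0. -/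
open Set MeasureTheory intervalIntegral

noncomputable section

/-- `K` solves the Goursat problem associated with `(a, p, q)` on the closed
triangle `{0 ≤ y ≤ x ≤ ℓ}` (closure of `Ω = {0 < y < x < ℓ}`): it is `C²` on
the closed triangle, satisfies the hyperbolic equation
`a(x)∂ₓ²K − ∂_y²(a(y)K) = (q(x) − p(y))K` in `Ω`, the boundary condition
`a(0)∂_yK(x,0) + a'(0)K(x,0) = 0`, the diagonal condition
`2a(x)(d/dx)K(x,x) + a'(x)K(x,x) = q(x) − p(x)` for `0 < x < ℓ`, and `K(0,0)=0`. -/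
def IsGoursatSol (ℓ : ℝ) (a p q : ℝ → ℝ) (K : ℝ → ℝ → ℝ) : Prop :=
  ContDiffOn ℝ 2 (fun z : ℝ × ℝ => K z.1 z.2)
      {z : ℝ × ℝ | 0 ≤ z.2 ∧ z.2 ≤ z.1 ∧ z.1 ≤ ℓ} ∧
  (∀ x y : ℝ, 0 < y → y < x → x < ℓ →
      a x * deriv (fun s => deriv (fun s' => K s' y) s) x
        - deriv (fun s => deriv (fun s' => a s' * K x s') s) y
        = (q x - p y) * K x y) ∧
  (∀ x : ℝ, 0 < x → x < ℓ →
      a 0 * derivWithin (fun s => K x s) (Icc 0 x) 0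
        + derivWithin a (Icc 0 ℓ) 0 * K x 0 = 0) ∧
  (∀ x : ℝ, 0 < x → x < ℓ →
      2 * a x * derivWithin (fun s => K s s) (Icc 0 ℓ) x
        + derivWithin a (Icc 0 ℓ) x * K x x = q x - p x) ∧
  K 0 0 = 0

open Topology Filter

lemma hasFDerivAt_of_partials {f f₁ f₂ : ℝ × ℝ → ℝ}
    (h₁ : ∀ x y, HasDerivAt (fun s => f (s, y)) (f₁ (x, y)) x)
    (h₂ : ∀ x y, HasDerivAt (fun t => f (x, t)) (f₂ (x, y)) y)
    (c₁ : Continuous f₁) (c₂ : Continuous f₂) (z : ℝ × ℝ) :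
    HasFDerivAt f (f₁ z • ContinuousLinearMap.fst ℝ ℝ ℝ + f₂ z • ContinuousLinearMap.snd ℝ ℝ ℝ)
      z := by
  have key := hasStrictFDerivAt_uncurry_coprod (𝕜 := ℝ) (u := z) (f := fun x y => f (x, y))
    (f₁ := fun x y => ContinuousLinearMap.toSpanSingleton ℝ (f₁ (x, y)))
    (f₂ := fun x y => ContinuousLinearMap.toSpanSingleton ℝ (f₂ (x, y)))
    (Eventually.of_forall fun v => (h₁ v.1 v.2).hasFDerivAt)
    (Eventually.of_forall fun v => (h₂ v.1 v.2).hasFDerivAt)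
    (((ContinuousLinearMap.toSpanSingletonCLE (𝕜 := ℝ) (E := ℝ)).continuous.comp c₁).continuousAt)
    (((ContinuousLinearMap.toSpanSingletonCLE (𝕜 := ℝ) (E := ℝ)).continuous.comp c₂).continuousAt)
  convert! key.hasFDerivAt using 1
  ext <;> simp [Function.HasUncurry.uncurry]

lemma contDiff_of_partials {f f₁ f₂ : ℝ × ℝ → ℝ} {n : ℕ}
    (h₁ : ∀ x y, HasDerivAt (fun s => f (s, y)) (f₁ (x, y)) x)
    (h₂ : ∀ x y, HasDerivAt (fun t => f (x, t)) (f₂ (x, y)) y)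
    (c₁ : ContDiff ℝ n f₁) (c₂ : ContDiff ℝ n f₂) : ContDiff ℝ (n + 1) f := by
  rw [contDiff_succ_iff_hasFDerivAt]
  refine ⟨_, ?_, fun z => hasFDerivAt_of_partials h₁ h₂ c₁.continuous c₂.continuous z⟩
  fun_prop

lemma hasDerivAt_param_integral {Q : ℝ → ℝ} (hQ : Continuous Q) {U U₁ : ℝ × ℝ → ℝ}
    (hU : Continuous U) (hU₁ : Continuous U₁)
    (h : ∀ x r, HasDerivAt (fun s => U (s, r)) (U₁ (x, r)) x) (x b : ℝ) :
    HasDerivAt (fun s => ∫ r in 0..b, Q r * U (s, r)) (∫ r in 0..b, Q r * U₁ (x, r)) x := by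
  have hc : IsCompact (Icc (x - 1) (x + 1) ×ˢ uIcc 0 b) := isCompact_Icc.prod isCompact_uIcc
  obtain ⟨C, hC⟩ := hc.exists_bound_of_continuousOn
    (f := fun z : ℝ × ℝ => Q z.2 * U₁ z) (by fun_prop)
  refine (intervalIntegral.hasDerivAt_integral_of_dominated_loc_of_deriv_le (μ := volume)
    (F := fun s r => Q r * U (s, r)) (F' := fun s r => Q r * U₁ (s, r))
    (s := Icc (x - 1) (x + 1)) (bound := fun _ => C) (Icc_mem_nhds (by linarith) (by linarith))
    (Eventually.of_forall fun s => ?_) ?_ ?_ ?_ ?_ ?_).2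
  · exact (by fun_prop : Continuous fun r => Q r * U (s, r)).aestronglyMeasurable
  · exact (by fun_prop : Continuous fun r => Q r * U (x, r)).intervalIntegrable _ _
  · exact (by fun_prop : Continuous fun r => Q r * U₁ (x, r)).aestronglyMeasurable
  · exact Eventually.of_forall fun r hr s hs => hC (s, r) ⟨hs, uIoc_subset_uIcc hr⟩
  · exact intervalIntegrable_const
  · exact Eventually.of_forall fun r hr s hs => (h s r).const_mul (Q r)

lemma continuous_integral_mul {Q : ℝ → ℝ} (hQ : Continuous Q) {U : ℝ × ℝ → ℝ}
    (hU : Continuous U) : Continuous fun z : ℝ × ℝ => ∫ r in 0..z.2, Q r * U (z.1, r) := by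
  have : Continuous (Function.uncurry fun (z : ℝ × ℝ) (r : ℝ) => Q r * U (z.1, r)) := by
    simp only [Function.uncurry_def]; fun_prop
  exact continuous_parametric_intervalIntegral_of_continuous this continuous_snd

lemma contDiff_one_integral_mul {Q : ℝ → ℝ} (hQ : Continuous Q) {U : ℝ × ℝ → ℝ}
    (hU : ContDiff ℝ 1 U) :
    ContDiff ℝ 1 fun z : ℝ × ℝ => ∫ r in 0..z.2, Q r * U (z.1, r) := by
  have hU₁ : Continuous fun z => fderiv ℝ U z (1, 0) := by
    have := hU.continuous_fderiv one_ne_zero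
    fun_prop
  have hd : ∀ x r, HasDerivAt (fun s => U (s, r)) (fderiv ℝ U (x, r) (1, 0)) x := fun x r =>
    (hU.differentiable one_ne_zero (x, r)).hasFDerivAt.comp_hasDerivAt x
      ((hasDerivAt_id x).prodMk (hasDerivAt_const x r))
  refine contDiff_of_partials (n := 0) (f₁ := fun z => ∫ r in 0..z.2, Q r * fderiv ℝ U (z.1, r) (1, 0))
    (f₂ := fun z => Q z.2 * U z) (fun x b => ?_) (fun x b => ?_) ?_ ?_
  · exact hasDerivAt_param_integral hQ hU.continuous hU₁ hd x b
  · have hc : Continuous fun r => Q r * U (x, r) := by have := hU.continuous; fun_prop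
    exact (hc.integral_hasStrictDerivAt 0 b).hasDerivAt
  · exact contDiff_zero.2 (continuous_integral_mul hQ hU₁)
  · have := hU.continuous
    exact contDiff_zero.2 (by fun_prop)

/-- Between two moving endpoints, with all arguments depending smoothly on a further parameter. -/
lemma contDiff_one_integral_mul_comp {Q : ℝ → ℝ} (hQ : Continuous Q) {U : ℝ × ℝ → ℝ}
    (hU : ContDiff ℝ 1 U) {p α β : ℝ × ℝ → ℝ} (hp : ContDiff ℝ 1 p) (hα : ContDiff ℝ 1 α)
    (hβ : ContDiff ℝ 1 β) :
    ContDiff ℝ 1 fun z : ℝ × ℝ => ∫ r in (α z)..(β z), Q r * U (p z, r) := by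
  have h := contDiff_one_integral_mul hQ hU
  have h1 := h.comp (hp.prodMk hβ)
  have h2 := h.comp (hp.prodMk hα)
  convert! h1.sub h2 using 2 with z
  have hc : Continuous fun r => Q r * U (p z, r) := by have := hU.continuous; fun_prop
  exact (integral_interval_sub_left (hc.intervalIntegrable _ _) (hc.intervalIntegrable _ _)).symm

/-- A second derivative along a line is a value of the second Fréchet derivative. -/
lemma deriv_deriv_line {E : Type*} [NormedAddCommGroup E] [NormedSpace ℝ E] {f : E → ℝ}
    {γ : ℝ → E} {e : E} (hγ : ∀ s, HasDerivAt γ e s) {x : ℝ} (hf : ContDiffAt ℝ 2 f (γ x)) :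
    deriv (fun s => deriv (fun s' => f (γ s')) s) x = fderiv ℝ (fderiv ℝ f) (γ x) e e := by
  have hev : (fun s => deriv (fun s' => f (γ s')) s) =ᶠ[𝓝 x] fun s => fderiv ℝ f (γ s) e := by
    have h1 : ∀ᶠ z in 𝓝 (γ x), ContDiffAt ℝ 2 f z := hf.eventually (by simp)
    filter_upwards [(hγ x).continuousAt.eventually h1] with s hs
    exact ((hs.differentiableAt two_ne_zero).hasFDerivAt.comp_hasDerivAt s (hγ s)).deriv
  rw [hev.deriv_eq]
  have h2 : DifferentiableAt ℝ (fderiv ℝ f) (γ x) :=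
    (hf.fderiv_right (m := 1) (by norm_num)).differentiableAt one_ne_zero
  exact ((h2.hasFDerivAt.comp_hasDerivAt x (hγ x)).clm_apply (hasDerivAt_const x e)).deriv.trans
    (by simp)

/-- A function of class `C^n` on a compact interval is the restriction of a `C^n` function. -/
lemma ContDiffOn.exists_contDiff_extension {ℓ : ℝ} (hℓ : 0 < ℓ) (n : ℕ) :
    ∀ {f : ℝ → ℝ}, ContDiffOn ℝ n f (Icc 0 ℓ) →
      ∃ g : ℝ → ℝ, ContDiff ℝ n g ∧ EqOn g f (Icc 0 ℓ) := by
  induction n with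
  | zero =>
    intro f hf
    refine ⟨IccExtend hℓ.le ((Icc 0 ℓ).domRestrict f), contDiff_zero.2 ?_, fun x hx => ?_⟩
    · exact (continuousOn_iff_continuous_domRestrict.1 hf.continuousOn).Icc_extend'
    · simp [IccExtend_of_mem _ _ hx]
  | succ n ih =>
    intro f hf
    have hu := uniqueDiffOn_Icc hℓ
    obtain ⟨g, hg, hgf⟩ := ih (hf.derivWithin hu (m := n) (by norm_cast))
    have hgd : ∀ x, HasDerivAt (fun x => f 0 + ∫ r in 0..x, g r) (g x) x := fun x =>
      (hg.continuous.integral_hasStrictDerivAt 0 x).hasDerivAt.const_add _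
    have hfd : ∀ x ∈ Icc 0 ℓ, HasDerivWithinAt f (g x) (Icc 0 ℓ) x := fun x hx => by
      rw [hgf hx]
      exact (hf.differentiableOn (by simp) x hx).hasDerivWithinAt
    refine ⟨fun x => f 0 + ∫ r in 0..x, g r, ?_, ?_⟩
    · push_cast
      rw [contDiff_succ_iff_deriv]
      refine ⟨fun x => (hgd x).differentiableAt, by simp, ?_⟩
      rwa [funext fun x => (hgd x).deriv]
    · refine eq_of_derivWithin_eq (a := 0) (b := ℓ)
        (fun x hx => (hgd x).differentiableAt.differentiableWithinAt)
        (fun x hx => (hfd x hx).differentiableWithinAt) (fun x hx => ?_) (by simp)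
      have hx' : x ∈ Icc 0 ℓ := ⟨hx.1, hx.2.le⟩
      rw [(hgd x).hasDerivWithinAt.derivWithin (hu x hx'), (hfd x hx').derivWithin (hu x hx')]

/-- The derivative along the first characteristic of a solution of `V_st = c V` with
`V_s(s, 0) = D s`. -/
def charDeriv (c : ℝ × ℝ → ℝ) (D : ℝ → ℝ) (V : ℝ × ℝ → ℝ) (z : ℝ × ℝ) : ℝ :=
  D z.1 + ∫ r in 0..z.2, c (z.1, r) * V (z.1, r)

/-- The trace on the line `s = t`, where `V_s - V_t + h V = 0`, of a solution of `V_st = c V`. -/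
def robinTrace (c : ℝ × ℝ → ℝ) (D : ℝ → ℝ) (h : ℝ) (V : ℝ × ℝ → ℝ) (t : ℝ) : ℝ :=
  2 * Real.exp (h * t) * ∫ r in 0..t, Real.exp (-(h * r)) * charDeriv c D V (r, r)

/-- The integral operator whose fixed points solve the Goursat problem in characteristic
coordinates. -/
def goursatOp (c : ℝ × ℝ → ℝ) (D : ℝ → ℝ) (h : ℝ) (V : ℝ × ℝ → ℝ) (z : ℝ × ℝ) : ℝ :=
  (∫ σ in z.2..z.1, charDeriv c D V (σ, z.2)) + robinTrace c D h V z.2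

/-- The derivative of `goursatOp` along the second characteristic. -/
def goursatOpSnd (c : ℝ × ℝ → ℝ) (D : ℝ → ℝ) (h : ℝ) (V : ℝ × ℝ → ℝ) (z : ℝ × ℝ) : ℝ :=
  (∫ σ in z.2..z.1, c (σ, z.2) * V (σ, z.2)) + charDeriv c D V (z.2, z.2)
    + h * robinTrace c D h V z.2

section goursatOp

variable {c V : ℝ × ℝ → ℝ} {D : ℝ → ℝ} {h : ℝ}

lemma continuous_charDeriv (hc : Continuous c) (hD : Continuous D) (hV : Continuous V) :
    Continuous (charDeriv c D V) := by
  have := continuous_integral_mul (Q := fun _ => 1) continuous_const (hc.mul hV)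
  simp only [one_mul, Pi.mul_apply] at this
  unfold charDeriv
  fun_prop

lemma hasDerivAt_charDeriv_snd (hc : Continuous c) (hV : Continuous V) (s t : ℝ) :
    HasDerivAt (fun t => charDeriv c D V (s, t)) (c (s, t) * V (s, t)) t := by
  have hk : Continuous fun r => c (s, r) * V (s, r) := by fun_prop
  exact (hk.integral_hasStrictDerivAt 0 t).hasDerivAt.const_add (D s)

lemma hasDerivAt_robinTrace (hc : Continuous c) (hD : Continuous D) (hV : Continuous V) (t : ℝ) :
    HasDerivAt (robinTrace c D h V)
      (h * robinTrace c D h V t + 2 * charDeriv c D V (t, t)) t := by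
  have hk : Continuous fun r => Real.exp (-(h * r)) * charDeriv c D V (r, r) := by
    have := continuous_charDeriv hc hD hV
    fun_prop
  have h1 := (hk.integral_hasStrictDerivAt 0 t).hasDerivAt
  have h2 : HasDerivAt (fun t => 2 * Real.exp (h * t)) (2 * (Real.exp (h * t) * h)) t := by
    simpa using (((hasDerivAt_id t).const_mul h).exp).const_mul 2
  refine (h2.mul h1).congr_deriv ?_
  have h3 : Real.exp (h * t) * Real.exp (-(h * t)) = 1 := by simp [← Real.exp_add]
  unfold robinTrace
  linear_combination 2 * charDeriv c D V (t, t) * h3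

lemma continuous_robinTrace (hc : Continuous c) (hD : Continuous D) (hV : Continuous V) :
    Continuous (robinTrace c D h V) :=
  continuous_iff_continuousAt.2 fun t => (hasDerivAt_robinTrace hc hD hV t).continuousAt

lemma hasDerivAt_goursatOp_fst (hc : Continuous c) (hD : Continuous D) (hV : Continuous V)
    (s t : ℝ) :
    HasDerivAt (fun s => goursatOp c D h V (s, t)) (charDeriv c D V (s, t)) s := by
  have hk : Continuous fun σ => charDeriv c D V (σ, t) := by
    have := continuous_charDeriv hc hD hV
    fun_prop
  exact (hk.integral_hasStrictDerivAt t s).hasDerivAt.add_const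
    (robinTrace c D h V t)

lemma hasDerivAt_goursatOp_snd (hc : Continuous c) (hD : Continuous D) (hV : Continuous V)
    (s t : ℝ) :
    HasDerivAt (fun t => goursatOp c D h V (s, t)) (goursatOpSnd c D h V (s, t)) t := by
  have hS := continuous_charDeriv hc hD hV
  have hS' : Continuous fun z : ℝ × ℝ => charDeriv c D V (z.2, z.1) := by fun_prop
  have hcV : Continuous fun z : ℝ × ℝ => c (z.2, z.1) * V (z.2, z.1) := by fun_prop
  have hR₁ : ∀ x b, HasDerivAt (fun x => ∫ σ in 0..b, charDeriv c D V (σ, x))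
      (∫ σ in 0..b, c (σ, x) * V (σ, x)) x := fun x b => by
    simpa using hasDerivAt_param_integral (Q := fun _ => 1) continuous_const hS' hcV
      (fun t σ => hasDerivAt_charDeriv_snd hc hV σ t) x b
  have hR₂ : ∀ x b, HasDerivAt (fun b => ∫ σ in 0..b, charDeriv c D V (σ, x))
      (charDeriv c D V (b, x)) b := fun x b => by
    have hk : Continuous fun σ => charDeriv c D V (σ, x) := by fun_prop
    exact (hk.integral_hasStrictDerivAt 0 b).hasDerivAt
  have hR := hasFDerivAt_of_partials (f := fun z => ∫ σ in 0..z.2, charDeriv c D V (σ, z.1))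
    (f₁ := fun z => ∫ σ in 0..z.2, c (σ, z.1) * V (σ, z.1))
    (f₂ := fun z => charDeriv c D V (z.2, z.1)) hR₁ hR₂
    (by simpa using continuous_integral_mul (Q := fun _ => 1) continuous_const hcV) hS' (t, t)
  have hdiag := hR.comp_hasDerivAt (f := fun t => (t, t)) t ((hasDerivAt_id t).prodMk (hasDerivAt_id t))
  have key := ((hR₁ t s).sub hdiag).add (hasDerivAt_robinTrace (h := h) hc hD hV t)
  have hi : ∀ t, ∫ σ in t..s, charDeriv c D V (σ, t) = (∫ σ in 0..s, charDeriv c D V (σ, t))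
      - ∫ σ in 0..t, charDeriv c D V (σ, t) := fun t => by
    have hk : Continuous fun σ => charDeriv c D V (σ, t) := by fun_prop
    exact (integral_interval_sub_left (hk.intervalIntegrable _ _)
      (hk.intervalIntegrable _ _)).symm
  have hi' : ∫ σ in t..s, c (σ, t) * V (σ, t) = (∫ σ in 0..s, c (σ, t) * V (σ, t))
      - ∫ σ in 0..t, c (σ, t) * V (σ, t) := by
    have hk : Continuous fun σ => c (σ, t) * V (σ, t) := by fun_prop
    exact (integral_interval_sub_left (hk.intervalIntegrable _ _)
      (hk.intervalIntegrable _ _)).symm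
  refine (key.congr_of_eventuallyEq (Eventually.of_forall fun t => ?_)).congr_deriv ?_
  · simp [goursatOp, hi]
  · simp [goursatOpSnd, hi']
    ring

lemma continuous_goursatOpSnd (hc : Continuous c) (hD : Continuous D) (hV : Continuous V) :
    Continuous (goursatOpSnd c D h V) := by
  have hS := continuous_charDeriv hc hD hV
  have hT := continuous_robinTrace (h := h) hc hD hV
  have hk : Continuous fun z : ℝ × ℝ => c (z.2, z.1) * V (z.2, z.1) := by fun_prop
  have h1 := continuous_integral_mul (Q := fun _ => 1) continuous_const hk
  simp only [one_mul] at h1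
  have h2 : Continuous fun z : ℝ × ℝ => ∫ σ in z.2..z.1, c (σ, z.2) * V (σ, z.2) := by
    refine ((h1.comp continuous_swap).sub
      (h1.comp (continuous_snd.prodMk continuous_snd))).congr fun z => ?_
    have hk : Continuous fun σ => c (σ, z.2) * V (σ, z.2) := by fun_prop
    exact integral_interval_sub_left (hk.intervalIntegrable _ _) (hk.intervalIntegrable _ _)
  unfold goursatOpSnd
  fun_prop

lemma contDiff_one_goursatOp (hc : Continuous c) (hD : Continuous D) (hV : Continuous V) :
    ContDiff ℝ 1 (goursatOp c D h V) :=
  contDiff_of_partials (n := 0) (hasDerivAt_goursatOp_fst hc hD hV)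
    (hasDerivAt_goursatOp_snd hc hD hV) (contDiff_zero.2 (continuous_charDeriv hc hD hV))
    (contDiff_zero.2 (continuous_goursatOpSnd hc hD hV))

end goursatOp

/-- The potential `Q(s + t) - P(s - t)`, which is merely continuous, does not limit the regularity
of a solution to `C^1`: it only enters through integrals along characteristics. -/
lemma contDiff_two_goursatOp {Q P : ℝ → ℝ} (hQ : Continuous Q) (hP : Continuous P) {D : ℝ → ℝ}
    (hD : ContDiff ℝ 1 D) (h : ℝ) {V : ℝ × ℝ → ℝ} (hV : ContDiff ℝ 1 V) :
    ContDiff ℝ 2 (goursatOp (fun z => Q (z.1 + z.2) - P (z.1 - z.2)) D h V) := by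
  set c : ℝ × ℝ → ℝ := fun z => Q (z.1 + z.2) - P (z.1 - z.2) with hcdef
  have hc : Continuous c := by fun_prop
  have hVc := hV.continuous
  have hS : ContDiff ℝ 1 (charDeriv c D V) := by
    have h1 := contDiff_one_integral_mul_comp hQ (U := fun z => V (z.1, z.2 - z.1))
      (by fun_prop) (p := Prod.fst) (α := Prod.fst) (β := fun z => z.1 + z.2) (by fun_prop)
      (by fun_prop) (by fun_prop)
    have h2 := contDiff_one_integral_mul_comp hP (U := fun z => V (z.1, z.1 - z.2))
      (by fun_prop) (p := Prod.fst) (α := fun z => z.1 - z.2) (β := Prod.fst) (by fun_prop)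
      (by fun_prop) (by fun_prop)
    have h3 : ContDiff ℝ 1 fun z : ℝ × ℝ => D z.1 := hD.comp contDiff_fst
    convert! h3.add (h1.sub h2) using 2 with z
    have e1 := integral_comp_add_left (fun r => Q r * V (z.1, r - z.1)) z.1 (a := 0) (b := z.2)
    have e2 := integral_comp_sub_left (fun r => P r * V (z.1, z.1 - r)) z.1 (a := 0) (b := z.2)
    simp only [add_sub_cancel_left, add_zero, sub_sub_cancel, sub_zero] at e1 e2
    simp only [charDeriv, hcdef, sub_mul]
    rw [← e1, ← e2, ← intervalIntegral.integral_sub]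
    · exact (by fun_prop : Continuous fun r => Q (z.1 + r) * V (z.1, r)).intervalIntegrable _ _
    · exact (by fun_prop : Continuous fun r => P (z.1 - r) * V (z.1, r)).intervalIntegrable _ _
  have hT : ContDiff ℝ 1 (robinTrace c D h V) := by
    refine contDiff_one_iff_deriv.2
      ⟨fun t => (hasDerivAt_robinTrace hc hD.continuous hVc t).differentiableAt, ?_⟩
    rw [funext fun t => (hasDerivAt_robinTrace (h := h) hc hD.continuous hVc t).deriv]
    have h1 := hS.continuous
    have h2 := continuous_robinTrace (h := h) hc hD.continuous hVc
    fun_prop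
  have hN : ContDiff ℝ 1 fun z : ℝ × ℝ => ∫ σ in z.2..z.1, c (σ, z.2) * V (σ, z.2) := by
    have h1 := contDiff_one_integral_mul_comp hQ (U := fun z => V (z.2 - z.1, z.1))
      (by fun_prop) (p := Prod.snd) (α := fun z => z.2 + z.2) (β := fun z => z.1 + z.2)
      (by fun_prop) (by fun_prop) (by fun_prop)
    have h2 := contDiff_one_integral_mul_comp hP (U := fun z => V (z.2 + z.1, z.1))
      (by fun_prop) (p := Prod.snd) (α := fun z => z.2 - z.2) (β := fun z => z.1 - z.2)
      (by fun_prop) (by fun_prop) (by fun_prop)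
    convert! h1.sub h2 using 2 with z
    have e1 := integral_comp_add_right (fun r => Q r * V (r - z.2, z.2)) z.2
      (a := z.2) (b := z.1)
    have e2 := integral_comp_sub_right (fun r => P r * V (r + z.2, z.2)) z.2
      (a := z.2) (b := z.1)
    simp only [add_sub_cancel_right, sub_add_cancel] at e1 e2
    simp only [hcdef, sub_mul]
    rw [← e1, ← e2, ← intervalIntegral.integral_sub]
    · exact (by fun_prop : Continuous fun r => Q (r + z.2) * V (r, z.2)).intervalIntegrable _ _
    · exact (by fun_prop : Continuous fun r => P (r - z.2) * V (r, z.2)).intervalIntegrable _ _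
  have hSnd : ContDiff ℝ 1 (goursatOpSnd c D h V) :=
    (hN.add (hS.comp (contDiff_snd.prodMk contDiff_snd))).add
      (contDiff_const.mul (hT.comp contDiff_snd))
  exact contDiff_of_partials (n := 1) (hasDerivAt_goursatOp_fst hc hD.continuous hVc)
    (hasDerivAt_goursatOp_snd hc hD.continuous hVc) hS hSnd

lemma abs_charDeriv_sub_le {c : ℝ × ℝ → ℝ} (hc : Continuous c) (D : ℝ → ℝ) {M C lam w : ℝ}
    (hlam : 0 < lam) (hC : ∀ s ∈ Icc (-M) M, ∀ t ∈ Icc (-M) M, |c (s, t)| ≤ C) {V₁ V₂ : ℝ × ℝ → ℝ}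
    (hV₁ : Continuous V₁) (hV₂ : Continuous V₂)
    (hw : ∀ s ∈ Icc (-M) M, ∀ t ∈ Icc (-M) M,
      |V₁ (s, t) - V₂ (s, t)| ≤ w * Real.cosh (lam * t))
    {s t : ℝ} (hs : s ∈ Icc (-M) M) (ht : t ∈ Icc (-M) M) :
    |charDeriv c D V₁ (s, t) - charDeriv c D V₂ (s, t)| ≤ C * w / lam * Real.cosh (lam * t) := by
  have hM : (0 : ℝ) ∈ Icc (-M) M := by
    have := hs.1.trans hs.2
    constructor <;> linarith
  have hC0 : 0 ≤ C := (abs_nonneg _).trans (hC s hs t ht)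
  have hw0 : 0 ≤ w := by
    have := (abs_nonneg _).trans (hw s hs t ht)
    exact nonneg_of_mul_nonneg_left this (Real.cosh_pos _)
  have h1 : charDeriv c D V₁ (s, t) - charDeriv c D V₂ (s, t)
      = ∫ r in 0..t, c (s, r) * (V₁ (s, r) - V₂ (s, r)) := by
    simp only [charDeriv, mul_sub]
    rw [intervalIntegral.integral_sub, add_sub_add_left_eq_sub]
    · exact (by fun_prop : Continuous fun r => c (s, r) * V₁ (s, r)).intervalIntegrable _ _
    · exact (by fun_prop : Continuous fun r => c (s, r) * V₂ (s, r)).intervalIntegrable _ _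
  have hcosh : Continuous fun r => C * w * Real.cosh (lam * r) := by fun_prop
  have h2 : ∫ r in 0..t, C * w * Real.cosh (lam * r) = C * w / lam * Real.sinh (lam * t) := by
    have hd : ∀ r ∈ uIcc 0 t, HasDerivAt (fun r => C * w / lam * Real.sinh (lam * r))
        (C * w * Real.cosh (lam * r)) r := fun r _ => by
      refine (((hasDerivAt_id r).const_mul lam).sinh.const_mul (C * w / lam)).congr_deriv ?_
      simp only [id, mul_one]
      field_simp
    rw [integral_eq_sub_of_hasDerivAt hd
      (hcosh.intervalIntegrable _ _)]
    simp
  have h3 : |∫ r in 0..t, c (s, r) * (V₁ (s, r) - V₂ (s, r))|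
      ≤ |∫ r in 0..t, C * w * Real.cosh (lam * r)| := by
    rw [← Real.norm_eq_abs]
    refine norm_integral_le_abs_of_norm_le ?_
      (hcosh.intervalIntegrable _ _)
    refine (ae_restrict_iff' measurableSet_uIoc).2 (Eventually.of_forall fun r hr => ?_)
    have hr' : r ∈ Icc (-M) M := (ordConnected_Icc.uIcc_subset hM ht) (uIoc_subset_uIcc hr)
    rw [Real.norm_eq_abs, abs_mul, mul_assoc]
    exact mul_le_mul (hC s hs r hr') (hw s hs r hr') (abs_nonneg _) hC0
  rw [h1]
  refine h3.trans ?_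
  rw [h2, abs_mul, abs_of_nonneg (by positivity)]
  refine mul_le_mul_of_nonneg_left ?_ (by positivity)
  rw [Real.abs_sinh]
  exact (Real.sinh_lt_cosh _).le.trans (Real.cosh_abs _).le

lemma abs_goursatOp_sub_le {c : ℝ × ℝ → ℝ} (hc : Continuous c) {D : ℝ → ℝ} (hD : Continuous D)
    (h : ℝ) {M C lam w : ℝ} (hlam : 0 < lam)
    (hC : ∀ s ∈ Icc (-M) M, ∀ t ∈ Icc (-M) M, |c (s, t)| ≤ C) {V₁ V₂ : ℝ × ℝ → ℝ}
    (hV₁ : Continuous V₁) (hV₂ : Continuous V₂)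
    (hw : ∀ s ∈ Icc (-M) M, ∀ t ∈ Icc (-M) M,
      |V₁ (s, t) - V₂ (s, t)| ≤ w * Real.cosh (lam * t))
    {s t : ℝ} (hs : s ∈ Icc (-M) M) (ht : t ∈ Icc (-M) M) :
    |goursatOp c D h V₁ (s, t) - goursatOp c D h V₂ (s, t)|
      ≤ C * w / lam * (2 * M + 2 * M * Real.exp (2 * |h| * M)) * Real.cosh (lam * t) := by
  have hM : (0 : ℝ) ∈ Icc (-M) M := by
    have := hs.1.trans hs.2
    constructor <;> linarith
  set k := C * w / lam with hk
  have hS := fun {s t : ℝ} (hs : s ∈ Icc (-M) M) (ht : t ∈ Icc (-M) M) =>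
    abs_charDeriv_sub_le hc D hlam hC hV₁ hV₂ hw hs ht
  have hk0 : 0 ≤ k :=
    nonneg_of_mul_nonneg_left ((abs_nonneg _).trans (hS hs ht)) (Real.cosh_pos (lam * t))
  have hS₁ := continuous_charDeriv hc hD hV₁
  have hS₂ := continuous_charDeriv hc hD hV₂
  have e1 : (∫ σ in t..s, charDeriv c D V₁ (σ, t)) - (∫ σ in t..s, charDeriv c D V₂ (σ, t))
      = ∫ σ in t..s, (charDeriv c D V₁ (σ, t) - charDeriv c D V₂ (σ, t)) := by
    rw [intervalIntegral.integral_sub]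
    · exact (by fun_prop : Continuous fun σ => charDeriv c D V₁ (σ, t)).intervalIntegrable _ _
    · exact (by fun_prop : Continuous fun σ => charDeriv c D V₂ (σ, t)).intervalIntegrable _ _
  have b1 : |∫ σ in t..s, (charDeriv c D V₁ (σ, t) - charDeriv c D V₂ (σ, t))|
      ≤ k * Real.cosh (lam * t) * (2 * M) := by
    rw [← Real.norm_eq_abs]
    refine (intervalIntegral.norm_integral_le_of_norm_le_const fun σ hσ =>
      (Real.norm_eq_abs _).trans_le <| hS ((ordConnected_Icc.uIcc_subset ht hs) (uIoc_subset_uIcc hσ)) ht).trans ?_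
    refine mul_le_mul_of_nonneg_left ?_ (mul_nonneg hk0 (Real.cosh_pos _).le)
    rw [abs_le]
    constructor <;> linarith [hs.1, hs.2, ht.1, ht.2]
  have e2 : robinTrace c D h V₁ t - robinTrace c D h V₂ t
      = 2 * Real.exp (h * t) * ∫ r in 0..t,
        Real.exp (-(h * r)) * (charDeriv c D V₁ (r, r) - charDeriv c D V₂ (r, r)) := by
    simp only [robinTrace, mul_sub (Real.exp _)]
    rw [intervalIntegral.integral_sub, mul_sub]
    · exact (by fun_prop : Continuous fun r =>
        Real.exp (-(h * r)) * charDeriv c D V₁ (r, r)).intervalIntegrable _ _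
    · exact (by fun_prop : Continuous fun r =>
        Real.exp (-(h * r)) * charDeriv c D V₂ (r, r)).intervalIntegrable _ _
  have hexp : ∀ r ∈ Icc (-M) M, h * r ≤ |h| * M ∧ -(h * r) ≤ |h| * M := fun r hr => by
    have h1 : |h * r| ≤ |h| * M := by
      rw [abs_mul]
      exact mul_le_mul_of_nonneg_left (abs_le.2 hr) (abs_nonneg h)
    exact ⟨(le_abs_self _).trans h1, (neg_le_abs _).trans h1⟩
  have b2 : |∫ r in 0..t,
        Real.exp (-(h * r)) * (charDeriv c D V₁ (r, r) - charDeriv c D V₂ (r, r))|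
      ≤ Real.exp (|h| * M) * (k * Real.cosh (lam * t)) * M := by
    rw [← Real.norm_eq_abs]
    refine (intervalIntegral.norm_integral_le_of_norm_le_const (C := Real.exp (|h| * M) * (k * Real.cosh (lam * t)))
      fun r hr => ?_).trans ?_
    · have hr' : r ∈ Icc (-M) M := (ordConnected_Icc.uIcc_subset hM ht) (uIoc_subset_uIcc hr)
      have hrt : |r| ≤ |t| := by
        have := abs_sub_left_of_mem_uIcc (uIoc_subset_uIcc hr)
        simpa using this
      rw [Real.norm_eq_abs, abs_mul, Real.abs_exp]
      refine mul_le_mul (Real.exp_le_exp.2 (hexp r hr').2) ((hS hr' hr').trans ?_) (abs_nonneg _)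
        (Real.exp_pos _).le
      refine mul_le_mul_of_nonneg_left ?_ hk0
      rw [Real.cosh_le_cosh, abs_mul, abs_mul]
      exact mul_le_mul_of_nonneg_left hrt (abs_nonneg _)
    · refine mul_le_mul_of_nonneg_left ?_
        (mul_nonneg (Real.exp_pos _).le (mul_nonneg hk0 (Real.cosh_pos _).le))
      simpa using abs_le.2 ht
  have b3 : |robinTrace c D h V₁ t - robinTrace c D h V₂ t|
      ≤ k * (2 * M * Real.exp (2 * |h| * M)) * Real.cosh (lam * t) := by
    rw [e2, abs_mul, abs_mul, Real.abs_exp, abs_two]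
    have : Real.exp (2 * |h| * M) = Real.exp (|h| * M) * Real.exp (|h| * M) := by
      rw [← Real.exp_add]; ring_nf
    calc 2 * Real.exp (h * t) * |∫ r in 0..t,
          Real.exp (-(h * r)) * (charDeriv c D V₁ (r, r) - charDeriv c D V₂ (r, r))|
        ≤ 2 * Real.exp (|h| * M) * (Real.exp (|h| * M) * (k * Real.cosh (lam * t)) * M) := by
          refine mul_le_mul (mul_le_mul_of_nonneg_left (Real.exp_le_exp.2 (hexp t ht).1) zero_le_two)
            b2 (abs_nonneg _) (by positivity)
      _ = _ := by rw [this]; ring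
  calc |goursatOp c D h V₁ (s, t) - goursatOp c D h V₂ (s, t)|
      = |((∫ σ in t..s, charDeriv c D V₁ (σ, t)) - (∫ σ in t..s, charDeriv c D V₂ (σ, t)))
        + (robinTrace c D h V₁ t - robinTrace c D h V₂ t)| := by
        simp only [goursatOp]; ring_nf
    _ ≤ k * Real.cosh (lam * t) * (2 * M)
        + k * (2 * M * Real.exp (2 * |h| * M)) * Real.cosh (lam * t) := by
        rw [e1]
        exact (abs_add_le _ _).trans (add_le_add b1 b3)
    _ = _ := by ring

lemma exists_goursatOp_fixed {c : ℝ × ℝ → ℝ} (hc : Continuous c) {D : ℝ → ℝ} (hD : Continuous D)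
    (h : ℝ) {M : ℝ} (hM : 0 ≤ M) :
    ∃ V : ℝ × ℝ → ℝ, Continuous V ∧
      ∀ s ∈ Icc (-M) M, ∀ t ∈ Icc (-M) M, goursatOp c D h V (s, t) = V (s, t) := by
  have hMM : -M ≤ M := by linarith
  obtain ⟨C, hC⟩ := (isCompact_Icc.prod isCompact_Icc :
    IsCompact (Icc (-M) M ×ˢ Icc (-M) M)).exists_bound_of_continuousOn hc.continuousOn
  have hC' : ∀ s ∈ Icc (-M) M, ∀ t ∈ Icc (-M) M, |c (s, t)| ≤ C := fun s hs t ht =>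
    hC (s, t) ⟨hs, ht⟩
  have h0 : (0 : ℝ) ∈ Icc (-M) M := ⟨by linarith, hM⟩
  have hC0 : 0 ≤ C := (abs_nonneg _).trans (hC' 0 h0 0 h0)
  set B := 2 * M + 2 * M * Real.exp (2 * |h| * M) with hB
  have hB0 : 0 ≤ B := by positivity
  set lam := 2 * (C * B) + 1 with hlamdef
  have hlam : 0 < lam := by positivity
  let X := C(Icc (-M) M × Icc (-M) M, ℝ)
  let ext : X → ℝ × ℝ → ℝ := fun W z =>
    Real.cosh (lam * z.2) * W (projIcc (-M) M hMM z.1, projIcc (-M) M hMM z.2)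
  have hext : ∀ W, Continuous (ext W) := fun W => by
    have h1 : Continuous (projIcc (-M) M hMM) := continuous_projIcc
    fun_prop
  let T : X → X := fun W =>
    ⟨fun z => (Real.cosh (lam * z.2))⁻¹ * goursatOp c D h (ext W) (z.1, z.2), by
      have h1 := (contDiff_one_goursatOp (h := h) hc hD (hext W)).continuous
      have h2 : ∀ z : Icc (-M) M × Icc (-M) M, Real.cosh (lam * z.2) ≠ 0 :=
        fun z => (Real.cosh_pos _).ne'
      fun_prop (disch := assumption)⟩
  have hT : ContractingWith (1 / 2) T := by
    refine ⟨by rw [← NNReal.coe_lt_coe]; norm_num, LipschitzWith.of_dist_le_mul fun W₁ W₂ => ?_⟩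
    refine (ContinuousMap.dist_le (by positivity)).2 fun z => ?_
    have hw : ∀ s ∈ Icc (-M) M, ∀ t ∈ Icc (-M) M,
        |ext W₁ (s, t) - ext W₂ (s, t)| ≤ dist W₁ W₂ * Real.cosh (lam * t) := fun s _ t _ => by
      simp only [ext]
      rw [← mul_sub, abs_mul, abs_of_pos (Real.cosh_pos _), mul_comm]
      exact mul_le_mul_of_nonneg_right (by
        rw [← Real.dist_eq]; exact ContinuousMap.dist_apply_le_dist _) (Real.cosh_pos _).le
    have key := abs_goursatOp_sub_le hc hD h hlam hC' (hext W₁) (hext W₂) hw z.1.2 z.2.2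
    have hch := Real.cosh_pos (lam * z.2)
    change |(Real.cosh (lam * z.2))⁻¹ * goursatOp c D h (ext W₁) (z.1, z.2)
      - (Real.cosh (lam * z.2))⁻¹ * goursatOp c D h (ext W₂) (z.1, z.2)| ≤ _
    rw [← mul_sub, abs_mul, abs_inv, abs_of_pos hch, inv_mul_le_iff₀ hch]
    refine key.trans ?_
    rw [mul_comm]
    refine mul_le_mul_of_nonneg_left ?_ hch.le
    rw [← hB, div_mul_eq_mul_div, div_le_iff₀ hlam]
    have hd : 0 ≤ dist W₁ W₂ := dist_nonneg
    have e : ((1 / 2 : NNReal) : ℝ) = 1 / 2 := by norm_num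
    rw [e, hlamdef]
    nlinarith
  have hfix := hT.fixedPoint_isFixedPt (f := T)
  set W := hT.fixedPoint T
  refine ⟨ext W, hext W, fun s hs t ht => ?_⟩
  have h1 : T W (⟨s, hs⟩, ⟨t, ht⟩) = W (⟨s, hs⟩, ⟨t, ht⟩) := by rw [hfix.eq]
  have h2 : (Real.cosh (lam * t))⁻¹ * goursatOp c D h (ext W) (s, t) = W (⟨s, hs⟩, ⟨t, ht⟩) := h1
  simp only [ext, projIcc_of_mem hMM hs, projIcc_of_mem hMM ht]
  rw [← h2, mul_inv_cancel_left₀ (Real.cosh_pos _).ne']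

lemma goursatOp_congr {c : ℝ × ℝ → ℝ} {D : ℝ → ℝ} {h M : ℝ} {V₁ V₂ : ℝ × ℝ → ℝ}
    (hV : ∀ s ∈ Icc (-M) M, ∀ t ∈ Icc (-M) M, V₁ (s, t) = V₂ (s, t))
    {s t : ℝ} (hs : s ∈ Icc (-M) M) (ht : t ∈ Icc (-M) M) :
    goursatOp c D h V₁ (s, t) = goursatOp c D h V₂ (s, t) := by
  have hM : (0 : ℝ) ∈ Icc (-M) M := by
    have := hs.1.trans hs.2
    constructor <;> linarith
  have hS : ∀ s ∈ Icc (-M) M, ∀ t ∈ Icc (-M) M,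
      charDeriv c D V₁ (s, t) = charDeriv c D V₂ (s, t) := fun s hs t ht => by
    simp only [charDeriv]
    congr 1
    exact integral_congr fun r hr => by
      simp only [hV s hs r (ordConnected_Icc.uIcc_subset hM ht hr)]
  simp only [goursatOp, robinTrace]
  congr 1
  · exact integral_congr fun σ hσ => hS σ (ordConnected_Icc.uIcc_subset ht hs hσ) t ht
  · congr 1
    exact integral_congr fun r hr => by
      have hr' := ordConnected_Icc.uIcc_subset hM ht hr
      simp only [hS r hr' r hr']

lemma exists_contDiff_goursatOp_fixed {Q P : ℝ → ℝ} (hQ : Continuous Q) (hP : Continuous P)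
    {D : ℝ → ℝ} (hD : ContDiff ℝ 1 D) (h : ℝ) {M : ℝ} (hM : 0 ≤ M) :
    ∃ V : ℝ × ℝ → ℝ, ContDiff ℝ 2 V ∧ ∀ s ∈ Icc (-M) M, ∀ t ∈ Icc (-M) M,
      goursatOp (fun z => Q (z.1 + z.2) - P (z.1 - z.2)) D h V (s, t) = V (s, t) := by
  set c : ℝ × ℝ → ℝ := fun z => Q (z.1 + z.2) - P (z.1 - z.2) with hcdef
  have hc : Continuous c := by fun_prop
  obtain ⟨V, hV, hfix⟩ := exists_goursatOp_fixed hc hD.continuous h hM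
  have h1 := contDiff_one_goursatOp (h := h) hc hD.continuous hV
  have hfix' : ∀ s ∈ Icc (-M) M, ∀ t ∈ Icc (-M) M,
      goursatOp c D h (goursatOp c D h V) (s, t) = goursatOp c D h V (s, t) :=
    fun s hs t ht => goursatOp_congr hfix hs ht
  exact ⟨_, contDiff_two_goursatOp hQ hP hD h h1, fun s hs t ht => goursatOp_congr hfix' hs ht⟩

/-- The wave operator in characteristic coordinates. -/
lemma sndFDeriv_characteristic {f : ℝ × ℝ → ℝ} {z : ℝ × ℝ} (hf : ContDiffAt ℝ 2 f z) :
    fderiv ℝ (fderiv ℝ f) z (1, 1) (1, 1) - fderiv ℝ (fderiv ℝ f) z (1, -1) (1, -1)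
      = 4 * fderiv ℝ (fderiv ℝ f) z (0, 1) (1, 0) := by
  have hsymm := (hf.isSymmSndFDerivAt (by simp)).eq (1, 0) (0, 1)
  have e1 : ((1, 1) : ℝ × ℝ) = (1, 0) + (0, 1) := by simp
  have e2 : ((1, -1) : ℝ × ℝ) = (1, 0) - (0, 1) := by simp
  rw [e1, e2]
  simp only [map_add, map_sub, add_apply, sub_apply]
  linear_combination 2 * hsymm

/-- Existence for the normal form `v_ξξ - v_ηη = (Q(ξ) - P(η)) v` of the Goursat problem. -/
lemma exists_normalForm_solution {Q P D : ℝ → ℝ} (hQ : Continuous Q) (hP : Continuous P)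
    (hD : ContDiff ℝ 1 D) (h : ℝ) {L : ℝ} (hL : 0 < L) :
    ∃ v : ℝ × ℝ → ℝ, ContDiff ℝ 2 v ∧
      (∀ ξ η : ℝ, 0 < η → η < ξ → ξ < L →
        deriv (fun s => deriv (fun s' => v (s', η)) s) ξ
          - deriv (fun s => deriv (fun s' => v (ξ, s')) s) η = (Q ξ - P η) * v (ξ, η)) ∧
      (∀ ξ, 0 < ξ → ξ < L → HasDerivAt (fun η => v (ξ, η)) (-h * v (ξ, 0)) 0) ∧
      (∀ ξ, 0 ≤ ξ → ξ ≤ L → v (ξ, ξ) = ∫ r in 0..ξ, D r) := by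
  set Q' : ℝ → ℝ := fun z => Q (z / 2) / 4 with hQ'
  set P' : ℝ → ℝ := fun z => P (z / 2) / 4 with hP'
  set D' : ℝ → ℝ := fun z => D (z / 2) / 2 with hD'
  have cQ' : Continuous Q' := by fun_prop
  have cP' : Continuous P' := by fun_prop
  have cD' : ContDiff ℝ 1 D' := by fun_prop
  obtain ⟨V, hV, hfix⟩ := exists_contDiff_goursatOp_fixed cQ' cP' cD' h
    (by positivity : 0 ≤ 2 * L)
  set c : ℝ × ℝ → ℝ := fun z => Q' (z.1 + z.2) - P' (z.1 - z.2) with hcdef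
  have hc : Continuous c := by fun_prop
  have hVc := hV.continuous
  have hVd : ∀ z, HasFDerivAt V (fderiv ℝ V z) z := fun z =>
    (hV.differentiable two_ne_zero z).hasFDerivAt
  have hnear : ∀ z ∈ Ioo (-(2 * L)) (2 * L) ×ˢ Ioo (-(2 * L)) (2 * L),
      ∀ᶠ z' in 𝓝 z, goursatOp c D' h V z' = V z' := fun z hz => by
    filter_upwards [(isOpen_Ioo.prod isOpen_Ioo).mem_nhds hz] with z' hz'
    exact hfix z'.1 (Ioo_subset_Icc_self hz'.1) z'.2 (Ioo_subset_Icc_self hz'.2)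
  have hfst : ∀ z ∈ Ioo (-(2 * L)) (2 * L) ×ˢ Ioo (-(2 * L)) (2 * L),
      fderiv ℝ V z (1, 0) = charDeriv c D' V z := fun z hz => by
    have h1 : HasDerivAt (fun s => V (s, z.2)) (fderiv ℝ V z (1, 0)) z.1 :=
      (hVd z).comp_hasDerivAt (f := fun s => (s, z.2)) z.1
        ((hasDerivAt_id z.1).prodMk (hasDerivAt_const z.1 z.2))
    have h2 := hasDerivAt_goursatOp_fst (h := h) hc cD'.continuous hVc z.1 z.2
    refine h1.unique (h2.congr_of_eventuallyEq ?_)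
    have h3 : ContinuousAt (fun s => (s, z.2)) z.1 := by fun_prop
    filter_upwards [h3.eventually (hnear z hz)] with s hs using hs.symm
  have hsnd : ∀ z ∈ Ioo (-(2 * L)) (2 * L) ×ˢ Ioo (-(2 * L)) (2 * L),
      fderiv ℝ V z (0, 1) = goursatOpSnd c D' h V z := fun z hz => by
    have h1 : HasDerivAt (fun t => V (z.1, t)) (fderiv ℝ V z (0, 1)) z.2 :=
      (hVd z).comp_hasDerivAt (f := fun t => (z.1, t)) z.2
        ((hasDerivAt_const z.2 z.1).prodMk (hasDerivAt_id z.2))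
    have h2 := hasDerivAt_goursatOp_snd (h := h) hc cD'.continuous hVc z.1 z.2
    refine h1.unique (h2.congr_of_eventuallyEq ?_)
    have h3 : ContinuousAt (fun t => (z.1, t)) z.2 := by fun_prop
    filter_upwards [h3.eventually (hnear z hz)] with s hs using hs.symm
  have hmix : ∀ z ∈ Ioo (-(2 * L)) (2 * L) ×ˢ Ioo (-(2 * L)) (2 * L),
      fderiv ℝ (fderiv ℝ V) z (0, 1) (1, 0) = c z * V z := fun z hz => by
    have h0 : DifferentiableAt ℝ (fderiv ℝ V) z :=
      (hV.fderiv_right (m := 1) (by norm_num)).differentiable one_ne_zero z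
    have h1 : HasDerivAt (fun t => fderiv ℝ V (z.1, t) (1, 0))
        (fderiv ℝ (fderiv ℝ V) z (0, 1) (1, 0)) z.2 := by
      simpa using (h0.hasFDerivAt.comp_hasDerivAt (f := fun t => (z.1, t)) z.2
        ((hasDerivAt_const z.2 z.1).prodMk (hasDerivAt_id z.2))).clm_apply
        (hasDerivAt_const z.2 ((1, 0) : ℝ × ℝ))
    have h2 := hasDerivAt_charDeriv_snd (D := D') hc hVc z.1 z.2
    refine h1.unique (h2.congr_of_eventuallyEq ?_)
    have h3 : ContinuousAt (fun t => (z.1, t)) z.2 := by fun_prop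
    filter_upwards [h3.eventually ((isOpen_Ioo.prod isOpen_Ioo).mem_nhds hz)] with t ht
    exact hfst _ ht
  refine ⟨fun z => V (z.1 + z.2, z.1 - z.2), by fun_prop, fun ξ η h1 h2 h3 => ?_,
    fun ξ h1 h2 => ?_, fun ξ h1 h2 => ?_⟩
  · have hγ₁ : ∀ s, HasDerivAt (fun s => (s + η, s - η)) ((1, 1) : ℝ × ℝ) s := fun s =>
      ((hasDerivAt_id s).add_const η).prodMk ((hasDerivAt_id s).sub_const η)
    have hγ₂ : ∀ s, HasDerivAt (fun s => (ξ + s, ξ - s)) ((1, -1) : ℝ × ℝ) s := fun s =>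
      ((hasDerivAt_id s).const_add ξ).prodMk ((hasDerivAt_id s).const_sub ξ)
    have d1 := deriv_deriv_line hγ₁ (x := ξ) hV.contDiffAt
    have d2 := deriv_deriv_line hγ₂ (x := η) hV.contDiffAt
    simp only
    rw [d1, d2, sndFDeriv_characteristic hV.contDiffAt, hmix]
    · simp only [hcdef, hQ', hP']
      ring_nf
    · constructor <;> constructor <;> simp only <;> linarith
  · have hz : (ξ, ξ) ∈ Ioo (-(2 * L)) (2 * L) ×ˢ Ioo (-(2 * L)) (2 * L) := by
      constructor <;> constructor <;> simp only <;> linarith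
    have hγ : HasDerivAt (fun s => (ξ + s, ξ - s)) ((1, -1) : ℝ × ℝ) 0 :=
      ((hasDerivAt_id (0 : ℝ)).const_add ξ).prodMk ((hasDerivAt_id (0 : ℝ)).const_sub ξ)
    refine ((hVd (ξ + 0, ξ - 0)).comp_hasDerivAt (f := fun s => (ξ + s, ξ - s)) 0 hγ).congr_deriv ?_
    have e2 : ((1, -1) : ℝ × ℝ) = (1, 0) - (0, 1) := by simp
    have hVξ := hfix ξ (Ioo_subset_Icc_self hz.1) ξ (Ioo_subset_Icc_self hz.2)
    simp only [goursatOp, integral_same, zero_add] at hVξ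
    simp only [add_zero, sub_zero]
    rw [e2, map_sub, hfst _ hz, hsnd _ hz, ← hVξ]
    simp only [goursatOpSnd, integral_same]
    ring
  · have hVξ := hfix (ξ + ξ) ⟨by linarith, by linarith⟩ (ξ - ξ) ⟨by linarith, by linarith⟩
    change V (ξ + ξ, ξ - ξ) = _
    rw [← hVξ]
    have := integral_comp_div (fun r => D r) (two_ne_zero' ℝ) (a := 0) (b := ξ + ξ)
    simp only [goursatOp, robinTrace, charDeriv, sub_self, integral_same, add_zero, mul_zero, hD',
      intervalIntegral.integral_div, this]
    simp

/-- An exponentially weighted bound on a derivative yields one for the function. -/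
lemma abs_le_mul_exp_of_hasDerivAt {f g : ℝ → ℝ} {a b k k' mu : ℝ} (hab : a ≤ b)
    (hf : ContinuousOn f (Icc a b)) (hfg : ∀ x ∈ Ioo a b, HasDerivAt f (g x) x)
    (hg : ∀ x ∈ Ioo a b, |g x| ≤ k * Real.exp (mu * x))
    (ha : |f a| ≤ k' * Real.exp (mu * a)) (hk : k ≤ mu * k') :
    |f b| ≤ k' * Real.exp (mu * b) := by
  have hE : ∀ x, HasDerivAt (fun x => k' * Real.exp (mu * x))
      (k' * (Real.exp (mu * x) * mu)) x := fun x => by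
    simpa using (((hasDerivAt_id x).const_mul mu).exp).const_mul k'
  have key : ∀ σ : ℝ, |σ| = 1 → 0 ≤ k' * Real.exp (mu * b) - σ * f b := fun σ hσ => by
    have hd : ∀ x ∈ Ioo a b, HasDerivAt (fun x => k' * Real.exp (mu * x) - σ * f x)
        (k' * (Real.exp (mu * x) * mu) - σ * g x) x := fun x hx =>
      (hE x).sub ((hfg x hx).const_mul σ)
    have hmono : MonotoneOn (fun x => k' * Real.exp (mu * x) - σ * f x) (Icc a b) := by
      refine monotoneOn_of_deriv_nonneg (convex_Icc a b) ?_ ?_ ?_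
      · exact (Continuous.continuousOn (by fun_prop)).sub (hf.const_smul σ)
      · rw [interior_Icc]
        exact fun x hx => (hd x hx).differentiableAt.differentiableWithinAt
      · rw [interior_Icc]
        intro x hx
        rw [(hd x hx).deriv]
        have h1 : σ * g x ≤ |g x| := by
          calc σ * g x ≤ |σ * g x| := le_abs_self _
            _ = |g x| := by rw [abs_mul, hσ, one_mul]
        have h2 := mul_le_mul_of_nonneg_right hk (Real.exp_pos (mu * x)).le
        linarith [hg x hx]
    have h1 := hmono (left_mem_Icc.2 hab) (right_mem_Icc.2 hab) hab
    have h2 : σ * f a ≤ |f a| := by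
      calc σ * f a ≤ |σ * f a| := le_abs_self _
        _ = |f a| := by rw [abs_mul, hσ, one_mul]
    simp only at h1
    linarith
  rw [abs_le]
  constructor
  · linarith [key (-1) (by simp)]
  · linarith [key 1 (by simp)]

/-- The closed triangle `{0 ≤ y ≤ x ≤ L}`. -/
def closedTriangle (L : ℝ) : Set (ℝ × ℝ) := {z | 0 ≤ z.2 ∧ z.2 ≤ z.1 ∧ z.1 ≤ L}

lemma convex_closedTriangle (L : ℝ) : Convex ℝ (closedTriangle L) := by
  rintro x ⟨h1, h2, h3⟩ y ⟨h4, h5, h6⟩ s t hs ht hst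
  obtain rfl : t = 1 - s := by linarith
  simp only [closedTriangle, mem_ofPred_eq, Prod.fst_add, Prod.snd_add, Prod.smul_fst,
    Prod.smul_snd, smul_eq_mul]
  refine ⟨by positivity, by gcongr, ?_⟩
  nlinarith

lemma isCompact_closedTriangle (L : ℝ) : IsCompact (closedTriangle L) := by
  refine (isCompact_Icc.prod isCompact_Icc : IsCompact (Icc 0 L ×ˢ Icc 0 L)).of_isClosed_subset
    ?_ fun z hz => ⟨⟨hz.1.trans hz.2.1, hz.2.2⟩, ⟨hz.1, hz.2.1.trans hz.2.2⟩⟩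
  exact (isClosed_le continuous_const continuous_snd).inter
    ((isClosed_le continuous_snd continuous_fst).inter
      (isClosed_le continuous_fst continuous_const))

lemma closedTriangle_mem_nhds {L ξ η : ℝ} (h1 : 0 < η) (h2 : η < ξ) (h3 : ξ < L) :
    closedTriangle L ∈ 𝓝 (ξ, η) := by
  have e1 : ∀ᶠ z : ℝ × ℝ in 𝓝 (ξ, η), 0 < z.2 := continuousAt_snd.eventually_const_lt h1
  have e2 : ∀ᶠ z : ℝ × ℝ in 𝓝 (ξ, η), z.2 < z.1 :=
    continuousAt_snd.eventually_lt continuousAt_fst h2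
  have e3 : ∀ᶠ z : ℝ × ℝ in 𝓝 (ξ, η), z.1 < L := continuousAt_fst.eventually_lt_const h3
  filter_upwards [e1, e2, e3] with z a b c using ⟨a.le, b.le, c.le⟩

lemma uniqueDiffOn_closedTriangle {L : ℝ} (hL : 0 < L) :
    UniqueDiffOn ℝ (closedTriangle L) :=
  uniqueDiffOn_convex (convex_closedTriangle L)
    ⟨(L / 2, L / 4), mem_interior_iff_mem_nhds.2
      (closedTriangle_mem_nhds (by linarith) (by linarith) (by linarith))⟩

/-- Uniqueness for the Goursat problem in normal form. -/
lemma eq_zero_of_normalForm {u : ℝ × ℝ → ℝ} {L C h : ℝ} (hL : 0 < L) (hC : 0 ≤ C)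
    (hu : ContDiffOn ℝ 2 u (closedTriangle L))
    (hpde : ∀ ξ η : ℝ, 0 < η → η < ξ → ξ < L →
      |deriv (fun s => deriv (fun s' => u (s', η)) s) ξ
        - deriv (fun s => deriv (fun s' => u (ξ, s')) s) η| ≤ C * |u (ξ, η)|)
    (hrob : ∀ ξ, 0 < ξ → ξ < L →
      HasDerivWithinAt (fun η => u (ξ, η)) (-h * u (ξ, 0)) (Icc 0 ξ) 0)
    (hdiag : ∀ ξ, 0 ≤ ξ → ξ ≤ L → u (ξ, ξ) = 0) :
    ∀ z ∈ closedTriangle L, u z = 0 := by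
  set T := closedTriangle L with hT
  have hun : UniqueDiffOn ℝ T := uniqueDiffOn_closedTriangle hL
  set f' := fderivWithin ℝ u T with hf'
  have hf'c : ContinuousOn f' T := hu.continuousOn_fderivWithin hun (by norm_num)
  have hfT : ∀ z ∈ T, HasFDerivWithinAt u (f' z) T z := fun z hz =>
    (hu.differentiableOn two_ne_zero z hz).hasFDerivWithinAt
  have hAc : ContinuousOn (fun z => f' z (1, 1)) T := hf'c.clm_apply continuousOn_const
  have hBc : ContinuousOn (fun z => f' z (1, -1)) T := hf'c.clm_apply continuousOn_const
  have hinterior : ∀ ξ η : ℝ, 0 < η → η < ξ → ξ < L →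
      HasFDerivAt u (f' (ξ, η)) (ξ, η) ∧ ∃ M : ℝ × ℝ →L[ℝ] ℝ × ℝ →L[ℝ] ℝ,
        HasFDerivAt f' M (ξ, η) ∧ |M (1, -1) (1, 1)| ≤ C * |u (ξ, η)| ∧
          |M (1, 1) (1, -1)| ≤ C * |u (ξ, η)| := fun ξ η h1 h2 h3 => by
    have hn := closedTriangle_mem_nhds h1 h2 h3
    have hcd : ContDiffAt ℝ 2 u (ξ, η) := hu.contDiffAt hn
    have hev : f' =ᶠ[𝓝 (ξ, η)] fderiv ℝ u := by
      filter_upwards [eventually_mem_nhds_iff.2 hn] with z hz using fderivWithin_of_mem_nhds hz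
    have hM : HasFDerivAt f' (fderiv ℝ (fderiv ℝ u) (ξ, η)) (ξ, η) :=
      (((hcd.fderiv_right (m := 1) (by norm_num)).differentiableAt
        one_ne_zero).hasFDerivAt).congr_of_eventuallyEq hev
    have hγ₁ : ∀ s, HasDerivAt (fun s => (s, η)) ((1, 0) : ℝ × ℝ) s := fun s =>
      (hasDerivAt_id s).prodMk (hasDerivAt_const s η)
    have hγ₂ : ∀ s, HasDerivAt (fun s => (ξ, s)) ((0, 1) : ℝ × ℝ) s := fun s =>
      (hasDerivAt_const s ξ).prodMk (hasDerivAt_id s)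
    have hp := hpde ξ η h1 h2 h3
    rw [deriv_deriv_line hγ₁ (x := ξ) hcd, deriv_deriv_line hγ₂ (x := η) hcd] at hp
    have hsymm := (hcd.isSymmSndFDerivAt (by simp)).eq (1, 0) (0, 1)
    have e1 : ((1, 1) : ℝ × ℝ) = (1, 0) + (0, 1) := by simp
    have e2 : ((1, -1) : ℝ × ℝ) = (1, 0) - (0, 1) := by simp
    refine ⟨(hfT _ (mem_of_mem_nhds hn)).hasFDerivAt hn, _, hM, ?_, ?_⟩ <;>
    · refine le_of_eq_of_le (congrArg _ ?_) hp
      rw [e1, e2]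
      simp only [map_add, map_sub, add_apply, sub_apply]
      linarith
  have hAdiag : ∀ ξ, 0 ≤ ξ → ξ ≤ L → f' (ξ, ξ) (1, 1) = 0 := fun ξ h1 h2 => by
    have hz : (ξ, ξ) ∈ T := ⟨h1, le_rfl, h2⟩
    have hγ : HasDerivWithinAt (fun s => (s, s)) ((1, 1) : ℝ × ℝ) (Icc 0 L) ξ :=
      ((hasDerivAt_id ξ).prodMk (hasDerivAt_id ξ)).hasDerivWithinAt
    have hd := (hfT _ hz).comp_hasDerivWithinAt (f := fun s => (s, s)) ξ hγ
      (fun s hs => ⟨hs.1, le_rfl, hs.2⟩)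
    refine (uniqueDiffOn_Icc hL ξ ⟨h1, h2⟩).eq_deriv _ hd ?_
    exact (hasDerivWithinAt_const ξ (Icc 0 L) (0 : ℝ)).congr
      (fun s hs => hdiag s hs.1 hs.2) (hdiag ξ h1 h2)
  have hBbdry : ∀ ξ, 0 < ξ → ξ < L →
      f' (ξ, 0) (1, -1) = f' (ξ, 0) (1, 1) + 2 * h * u (ξ, 0) := fun ξ h1 h2 => by
    have hz : (ξ, 0) ∈ T := ⟨le_rfl, h1.le, h2.le⟩
    have hγ : HasDerivWithinAt (fun s => (ξ, s)) ((0, 1) : ℝ × ℝ) (Icc 0 ξ) 0 :=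
      ((hasDerivAt_const (0 : ℝ) ξ).prodMk (hasDerivAt_id (0 : ℝ))).hasDerivWithinAt
    have hd := (hfT _ hz).comp_hasDerivWithinAt (f := fun s => (ξ, s)) 0 hγ
      (fun s hs => ⟨hs.1, hs.2, h2.le⟩)
    have heq := (uniqueDiffOn_Icc h1 0 ⟨le_rfl, h1.le⟩).eq_deriv _ hd (hrob ξ h1 h2)
    have e : ((1, -1) : ℝ × ℝ) = (1, 1) - (2 : ℝ) • (0, 1) := by
      ext <;> norm_num
    rw [e, map_sub, map_smul, heq, smul_eq_mul]
    ring
  set mu : ℝ := 1 + 2 * (C + 2 * |h|) with hmu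
  have hmu1 : 1 ≤ mu := by rw [hmu]; linarith [abs_nonneg h]
  have hmu0 : 0 < mu := by linarith
  have hubound : ∀ m : ℝ, 0 ≤ m →
      (∀ ξ η : ℝ, 0 < η → η < ξ → ξ < L → |f' (ξ, η) (1, -1)| ≤ m * Real.exp (mu * ξ)) →
      ∀ z ∈ T, |u z| ≤ m / mu * Real.exp (mu * z.1) := fun m hm hB z hz => by
    obtain ⟨ξ, η⟩ := z
    obtain ⟨h1, h2, h3⟩ := hz
    simp only at h1 h2 h3
    have := abs_le_mul_exp_of_hasDerivAt (f := fun r => u (r, ξ + η - r))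
      (g := fun r => f' (r, ξ + η - r) (1, -1)) (a := (ξ + η) / 2) (b := ξ) (k := m)
      (k' := m / mu) (mu := mu) (by linarith) ?_ ?_ ?_ ?_ ?_
    · simpa using this
    · refine hu.continuousOn.comp (Continuous.continuousOn (by fun_prop)) fun r hr => ?_
      exact ⟨by linarith [hr.2], by linarith [hr.1], by linarith [hr.2]⟩
    · intro r hr
      exact (hinterior r (ξ + η - r) (by linarith [hr.2]) (by linarith [hr.1])
        (by linarith [hr.2])).1.comp_hasDerivAt (f := fun r => (r, ξ + η - r)) r
        ((hasDerivAt_id r).prodMk ((hasDerivAt_id r).const_sub (ξ + η)))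
    · exact fun r hr => hB r _ (by linarith [hr.2]) (by linarith [hr.1]) (by linarith [hr.2])
    · rw [show ξ + η - (ξ + η) / 2 = (ξ + η) / 2 by ring,
        hdiag _ (by linarith) (by linarith), abs_zero]
      positivity
    · rw [mul_div_cancel₀ _ hmu0.ne']
  have hAbound : ∀ m : ℝ, 0 ≤ m →
      (∀ z ∈ T, |u z| ≤ m * Real.exp (mu * z.1)) →
      ∀ z ∈ T, |f' z (1, 1)| ≤ C * m / mu * Real.exp (mu * z.1) := fun m hm hub z hz => by
    obtain ⟨ξ, η⟩ := z
    obtain ⟨h1, h2, h3⟩ := hz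
    simp only at h1 h2 h3
    have hmem : ∀ r ∈ Icc ((ξ + η) / 2) ξ, (r, ξ + η - r) ∈ T := fun r hr =>
      ⟨by linarith [hr.2], by linarith [hr.1], by linarith [hr.2]⟩
    have hder : ∀ r ∈ Ioo ((ξ + η) / 2) ξ, ∃ d, HasDerivAt (fun r => f' (r, ξ + η - r) (1, 1)) d r
        ∧ |d| ≤ C * m * Real.exp (mu * r) := fun r hr => by
      obtain ⟨-, M, hM, hM1, -⟩ := hinterior r (ξ + η - r) (by linarith [hr.2]) (by linarith [hr.1])
        (by linarith [hr.2])
      refine ⟨_, (hM.comp_hasDerivAt (f := fun r => (r, ξ + η - r)) r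
        ((hasDerivAt_id r).prodMk ((hasDerivAt_id r).const_sub (ξ + η)))).clm_apply
        (hasDerivAt_const r ((1, 1) : ℝ × ℝ)), ?_⟩
      have := mul_le_mul_of_nonneg_left (hub _ (hmem r (Ioo_subset_Icc_self hr))) hC
      simpa [mul_assoc] using hM1.trans this
    have := abs_le_mul_exp_of_hasDerivAt (f := fun r => f' (r, ξ + η - r) (1, 1))
      (g := deriv fun r => f' (r, ξ + η - r) (1, 1)) (a := (ξ + η) / 2) (b := ξ) (k := C * m)
      (k' := C * m / mu) (mu := mu) (by linarith) ?_ ?_ ?_ ?_ ?_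
    · simpa using this
    · exact hAc.comp (Continuous.continuousOn (by fun_prop)) hmem
    · intro r hr
      obtain ⟨d, hd, -⟩ := hder r hr
      exact hd.differentiableAt.hasDerivAt
    · intro r hr
      obtain ⟨d, hd, hd'⟩ := hder r hr
      rwa [hd.deriv]
    · rw [show ξ + η - (ξ + η) / 2 = (ξ + η) / 2 by ring,
        hAdiag _ (by linarith) (by linarith), abs_zero]
      positivity
    · rw [mul_div_cancel₀ _ hmu0.ne']
  have hstep : ∀ m : ℝ, 0 ≤ m →
      (∀ ξ η : ℝ, 0 < η → η < ξ → ξ < L → |f' (ξ, η) (1, -1)| ≤ m * Real.exp (mu * ξ)) →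
      ∀ ξ η : ℝ, 0 < η → η < ξ → ξ < L →
        |f' (ξ, η) (1, -1)| ≤ m / 2 * Real.exp (mu * ξ) := fun m hm hB ξ η h1 h2 h3 => by
    have hub := hubound m hm hB
    have hm' : 0 ≤ m / mu := by positivity
    have hAb := hAbound (m / mu) hm' hub
    have hmm : m = mu * (m / mu) := (mul_div_cancel₀ _ hmu0.ne').symm
    have hsmall : C * (m / mu) / mu + 2 * |h| * (m / mu) ≤ m / 2 := by
      have : C * (m / mu) / mu ≤ C * (m / mu) := div_le_self (by positivity) hmu1
      have h5 : (C + 2 * |h|) * (m / mu) ≤ mu / 2 * (m / mu) := by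
        gcongr
        rw [hmu]
        linarith
      linarith
    have hmem : ∀ r ∈ Icc (ξ - η) ξ, (r, r - (ξ - η)) ∈ T := fun r hr =>
      ⟨by linarith [hr.1], by linarith, by linarith [hr.2]⟩
    have hder : ∀ r ∈ Ioo (ξ - η) ξ, ∃ d,
        HasDerivAt (fun r => f' (r, r - (ξ - η)) (1, -1)) d r
        ∧ |d| ≤ C * (m / mu) * Real.exp (mu * r) := fun r hr => by
      obtain ⟨-, M, hM, -, hM1⟩ := hinterior r (r - (ξ - η)) (by linarith [hr.1]) (by linarith)
        (by linarith [hr.2])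
      refine ⟨_, (hM.comp_hasDerivAt (f := fun r => (r, r - (ξ - η))) r
        ((hasDerivAt_id r).prodMk ((hasDerivAt_id r).sub_const (ξ - η)))).clm_apply
        (hasDerivAt_const r ((1, -1) : ℝ × ℝ)), ?_⟩
      have := mul_le_mul_of_nonneg_left (hub _ (hmem r (Ioo_subset_Icc_self hr))) hC
      simpa [mul_assoc] using hM1.trans this
    have := abs_le_mul_exp_of_hasDerivAt (f := fun r => f' (r, r - (ξ - η)) (1, -1))
      (g := deriv fun r => f' (r, r - (ξ - η)) (1, -1)) (a := ξ - η) (b := ξ)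
      (k := C * (m / mu))
      (k' := m / 2) (mu := mu) (by linarith) ?_ ?_ ?_ ?_ ?_
    · simpa using this
    · exact hBc.comp (Continuous.continuousOn (by fun_prop)) hmem
    · intro r hr
      obtain ⟨d, hd, -⟩ := hder r hr
      exact hd.differentiableAt.hasDerivAt
    · intro r hr
      obtain ⟨d, hd, hd'⟩ := hder r hr
      rwa [hd.deriv]
    · have hz : (ξ - η, (0 : ℝ)) ∈ T := ⟨le_rfl, by simp only; linarith, by simp only; linarith⟩
      rw [sub_self, hBbdry _ (by linarith) (by linarith)]
      calc |f' (ξ - η, 0) (1, 1) + 2 * h * u (ξ - η, 0)|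
          ≤ |f' (ξ - η, 0) (1, 1)| + 2 * |h| * |u (ξ - η, 0)| := by
            refine (abs_add_le _ _).trans_eq ?_
            rw [abs_mul, abs_mul, abs_two]
        _ ≤ C * (m / mu) / mu * Real.exp (mu * (ξ - η))
            + 2 * |h| * (m / mu * Real.exp (mu * (ξ - η))) := by
            gcongr
            · exact hAb _ hz
            · exact hub _ hz
        _ = (C * (m / mu) / mu + 2 * |h| * (m / mu)) * Real.exp (mu * (ξ - η)) := by ring
        _ ≤ m / 2 * Real.exp (mu * (ξ - η)) := by gcongr
    · have h5 : C * (m / mu) ≤ mu / 2 * (m / mu) := by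
        gcongr
        rw [hmu]
        linarith [abs_nonneg h]
      have h6 : m / 2 ≤ mu * (m / 2) := le_mul_of_one_le_left (by positivity) hmu1
      linarith
  obtain ⟨m₀, hm₀⟩ := (isCompact_closedTriangle L).exists_bound_of_continuousOn hBc
  have hm₀' : 0 ≤ m₀ := (norm_nonneg _).trans (hm₀ (0, 0) ⟨le_rfl, le_rfl, hL.le⟩)
  have hiter : ∀ n : ℕ, ∀ ξ η : ℝ, 0 < η → η < ξ → ξ < L →
      |f' (ξ, η) (1, -1)| ≤ m₀ / 2 ^ n * Real.exp (mu * ξ) := fun n => by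
    induction n with
    | zero =>
      intro ξ η h1 h2 h3
      have h4 := hm₀ (ξ, η) ⟨h1.le, h2.le, h3.le⟩
      have h5 : 1 ≤ Real.exp (mu * ξ) := Real.one_le_exp (by nlinarith)
      rw [pow_zero, div_one]
      exact h4.trans (le_mul_of_one_le_right hm₀' h5)
    | succ n ih =>
      have := hstep _ (by positivity) ih
      rwa [div_div, ← pow_succ] at this
  have hB0 : ∀ ξ η : ℝ, 0 < η → η < ξ → ξ < L →
      |f' (ξ, η) (1, -1)| ≤ 0 * Real.exp (mu * ξ) := fun ξ η h1 h2 h3 => by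
    have ht : Tendsto (fun n : ℕ => m₀ / 2 ^ n * Real.exp (mu * ξ)) atTop
        (𝓝 (0 * Real.exp (mu * ξ))) :=
      (tendsto_const_nhds.div_atTop (tendsto_pow_atTop_atTop_of_one_lt one_lt_two)).mul_const _
    exact ge_of_tendsto' ht fun n => hiter n ξ η h1 h2 h3
  intro z hz
  have := hubound 0 le_rfl hB0 z hz
  simpa using this

/-- The data of the Liouville change of variables for `a = exp (4θ)` on `[0, ℓ]`. -/
structure LiouvilleChange (ℓ : ℝ) (a : ℝ → ℝ) where
  /-- A quarter of the logarithm of `a`. -/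
  θ : ℝ → ℝ
  /-- The primitive of `a ^ (-1/2)`. -/
  φ : ℝ ≃o ℝ
  contDiff_θ : ContDiff ℝ 2 θ
  hasDerivAt_φ : ∀ x, HasDerivAt φ (Real.exp (-2 * θ x)) x
  map_zero : φ 0 = 0
  eq_exp : ∀ x ∈ Icc (0 : ℝ) ℓ, a x = Real.exp (4 * θ x)

namespace LiouvilleChange

lemma nonempty {ℓ : ℝ} (hℓ : 0 < ℓ) {a : ℝ → ℝ} (ha : ContDiffOn ℝ 2 a (Icc 0 ℓ))
    (hapos : ∀ x ∈ Icc (0 : ℝ) ℓ, 0 < a x) : Nonempty (LiouvilleChange ℓ a) := by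
  have hlog : ContDiffOn ℝ (2 : ℕ) (fun x => Real.log (a x) / 4) (Icc 0 ℓ) :=
    (ha.log fun x hx => (hapos x hx).ne').div_const 4
  obtain ⟨g, hg, hgl⟩ := hlog.exists_contDiff_extension hℓ 2
  let b : ContDiffBump (ℓ / 2) := ⟨ℓ / 2, ℓ, by linarith, by linarith⟩
  set θ : ℝ → ℝ := fun x => b x * g x with hθ
  have hθc : ContDiff ℝ 2 θ := b.contDiff.mul hg
  obtain ⟨C, hC⟩ := (b.hasCompactSupport.mul_right (f' := g)).exists_bound_of_continuous
    hθc.continuous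
  set φ : ℝ → ℝ := fun x => ∫ r in 0..x, Real.exp (-2 * θ r) with hφ
  have hec : Continuous fun r => Real.exp (-2 * θ r) := by
    have := hθc.continuous
    fun_prop
  have hd : ∀ x, HasDerivAt φ (Real.exp (-2 * θ x)) x := fun x =>
    (hec.integral_hasStrictDerivAt 0 x).hasDerivAt
  have hmono : StrictMono φ := strictMono_of_deriv_pos fun x => by
    rw [(hd x).deriv]
    exact Real.exp_pos _
  have hφ0 : φ 0 = 0 := integral_same
  set c := Real.exp (-2 * C) with hc
  have hc0 : 0 < c := Real.exp_pos _
  have hd' : ∀ x, HasDerivAt (fun x => φ x - c * x) (Real.exp (-2 * θ x) - c) x := fun x => by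
    simpa only [mul_one] using! (hd x).sub ((hasDerivAt_id x).const_mul c)
  have hmono' : Monotone fun x => φ x - c * x :=
    monotone_of_deriv_nonneg (fun x => (hd' x).differentiableAt) fun x => by
      rw [(hd' x).deriv, sub_nonneg, hc]
      have : θ x ≤ C := (le_abs_self _).trans (hC x)
      exact Real.exp_le_exp.2 (by linarith)
  have hsurj : Function.Surjective φ := by
    refine Continuous.surjective (continuous_iff_continuousAt.2 fun x => (hd x).continuousAt)
      ?_ ?_
    · refine tendsto_atTop_mono' _ ?_ (tendsto_id.const_mul_atTop hc0)
      filter_upwards [eventually_ge_atTop 0] with x hx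
      have := hmono' hx
      simp only [hφ0, mul_zero, sub_zero] at this
      simp only [id]
      linarith
    · refine tendsto_atBot_mono' _ ?_ (tendsto_id.const_mul_atBot hc0)
      filter_upwards [eventually_le_atBot 0] with x hx
      have := hmono' hx
      simp only [hφ0, mul_zero, sub_zero] at this
      simp only [id]
      linarith
  refine ⟨⟨θ, hmono.orderIsoOfSurjective φ hsurj, hθc, hd, hφ0, fun x hx => ?_⟩⟩
  have hbx : b x = 1 := b.one_of_mem_closedBall (by
    change dist x (ℓ / 2) ≤ ℓ / 2
    rw [Real.dist_eq, abs_le]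
    constructor
    · linarith [hx.1]
    · linarith [hx.2])
  rw [hθ]
  simp only
  rw [hbx, one_mul, hgl hx, mul_div_cancel₀ _ four_ne_zero, Real.exp_log (hapos x hx)]

variable {ℓ : ℝ} {a : ℝ → ℝ} (T : LiouvilleChange ℓ a)

lemma hasDerivAt_θ (x : ℝ) : HasDerivAt T.θ (deriv T.θ x) x :=
  (T.contDiff_θ.differentiable two_ne_zero x).hasDerivAt

lemma hasDerivAt_deriv_θ (x : ℝ) : HasDerivAt (deriv T.θ) (deriv (deriv T.θ) x) x :=
  (((contDiff_succ_iff_deriv (n := 1)).1 T.contDiff_θ).2.2.differentiable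
    one_ne_zero x).hasDerivAt

lemma continuous_deriv_deriv_θ : Continuous (deriv (deriv T.θ)) :=
  ((contDiff_succ_iff_deriv (n := 1)).1 T.contDiff_θ).2.2.continuous_deriv le_rfl

lemma contDiff_φ : ContDiff ℝ 2 T.φ := by
  refine (contDiff_succ_iff_deriv (n := 1)).2
    ⟨fun x => (T.hasDerivAt_φ x).differentiableAt, by simp, ?_⟩
  rw [funext fun x => (T.hasDerivAt_φ x).deriv]
  have := T.contDiff_θ.of_le (m := 1) (by norm_num)
  fun_prop

lemma contDiff_φ_symm : ContDiff ℝ 2 T.φ.symm :=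
  T.φ.toHomeomorph.contDiff_symm_deriv (fun _ => (Real.exp_pos _).ne') T.hasDerivAt_φ
    T.contDiff_φ

lemma φ_pos {x : ℝ} : 0 < T.φ x ↔ 0 < x := by
  simpa only [T.map_zero] using T.φ.lt_iff_lt (x := 0) (y := x)

lemma φ_nonneg {x : ℝ} : 0 ≤ T.φ x ↔ 0 ≤ x := by
  simpa only [T.map_zero] using T.φ.le_iff_le (x := 0) (y := x)

lemma hasDerivWithinAt {x : ℝ} (hx : x ∈ Icc 0 ℓ) :
    HasDerivWithinAt a (4 * deriv T.θ x * Real.exp (4 * T.θ x)) (Icc 0 ℓ) x := by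
  have h1 := (((T.hasDerivAt_θ x).const_mul 4).exp).hasDerivWithinAt (s := Icc 0 ℓ)
  exact (h1.congr T.eq_exp (T.eq_exp x hx)).congr_deriv (by ring)

/-- The potential created by the Liouville change of variables. -/
def potential (x : ℝ) : ℝ :=
  Real.exp (4 * T.θ x) * (deriv (deriv T.θ) x + deriv T.θ x ^ 2)

lemma continuous_potential : Continuous T.potential := by
  have h1 := T.continuous_deriv_deriv_θ
  have h2 := T.contDiff_θ.continuous
  have h3 := T.contDiff_θ.continuous_deriv (by norm_num)
  unfold potential
  fun_prop

lemma deriv_deriv_exp_mul_comp {f : ℝ → ℝ} {x : ℝ} (hf : ContDiffAt ℝ 2 f (T.φ x)) :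
    deriv (fun s => deriv (fun s' => Real.exp (T.θ s') * f (T.φ s')) s) x
      = Real.exp (-3 * T.θ x) * (T.potential x * f (T.φ x) + deriv (deriv f) (T.φ x)) := by
  have hE : ∀ s, HasDerivAt (fun s => Real.exp (T.θ s)) (Real.exp (T.θ s) * deriv T.θ s) s :=
    fun s => (T.hasDerivAt_θ s).exp
  have hE' : ∀ s, HasDerivAt (fun s => Real.exp (-T.θ s))
      (Real.exp (-T.θ s) * -deriv T.θ s) s := fun s => (T.hasDerivAt_θ s).neg.exp
  have hfφ : ∀ s, DifferentiableAt ℝ f (T.φ s) →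
      HasDerivAt (fun s => f (T.φ s)) (deriv f (T.φ s) * Real.exp (-2 * T.θ s)) s :=
    fun s hs => hs.hasDerivAt.comp s (T.hasDerivAt_φ s)
  have hev : (fun s => deriv (fun s' => Real.exp (T.θ s') * f (T.φ s')) s) =ᶠ[𝓝 x]
      fun s => Real.exp (T.θ s) * deriv T.θ s * f (T.φ s)
        + Real.exp (-T.θ s) * deriv f (T.φ s) := by
    have h1 : ∀ᶠ z in 𝓝 (T.φ x), ContDiffAt ℝ 2 f z := hf.eventually (by simp)
    filter_upwards [(T.hasDerivAt_φ x).continuousAt.eventually h1] with s hs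
    refine ((hE s).mul (hfφ s (hs.differentiableAt two_ne_zero))).deriv.trans ?_
    have : Real.exp (-T.θ s) = Real.exp (T.θ s) * Real.exp (-2 * T.θ s) := by
      rw [← Real.exp_add]
      ring_nf
    rw [this]
    ring
  have hf' : DifferentiableAt ℝ (deriv f) (T.φ x) :=
    ((hf.fderiv_right (m := 1) (by norm_num)).differentiableAt one_ne_zero).clm_apply
      (differentiableAt_const (1 : ℝ))
  have hf'φ : HasDerivAt (fun s => deriv f (T.φ s))
      (deriv (deriv f) (T.φ x) * Real.exp (-2 * T.θ x)) x :=
    hf'.hasDerivAt.comp x (T.hasDerivAt_φ x)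
  rw [hev.deriv_eq]
  refine (((((hE x).mul (T.hasDerivAt_deriv_θ x)).mul
    (hfφ x (hf.differentiableAt two_ne_zero))).add ((hE' x).mul hf'φ))).deriv.trans ?_
  have e1 : Real.exp (-T.θ x) = Real.exp (T.θ x) * Real.exp (-2 * T.θ x) := by
    rw [← Real.exp_add]
    ring_nf
  have e2 : Real.exp (-3 * T.θ x)
      = Real.exp (T.θ x) * Real.exp (-2 * T.θ x) * Real.exp (-2 * T.θ x) := by
    rw [← Real.exp_add, ← Real.exp_add]
    ring_nf
  have e3 : Real.exp (4 * T.θ x) * Real.exp (-2 * T.θ x) * Real.exp (-2 * T.θ x) = 1 := by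
    rw [← Real.exp_add, ← Real.exp_add, ← Real.exp_zero]
    ring_nf
  rw [potential, e1, e2, Pi.mul_apply]
  linear_combination (-(deriv (deriv T.θ) x + deriv T.θ x ^ 2) * f (T.φ x)
    * Real.exp (T.θ x)) * e3

end LiouvilleChange

/-- `u` solves the normal form `u_ξξ - u_ηη = (Q(ξ) - P(η)) u` of the Goursat problem, with a
Robin condition on `η = 0` and prescribed values on the diagonal. -/
def IsNormalFormSol (L : ℝ) (Q P D : ℝ → ℝ) (h : ℝ) (u : ℝ × ℝ → ℝ) : Prop :=
  ContDiffOn ℝ 2 u (closedTriangle L) ∧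
  (∀ ξ η : ℝ, 0 < η → η < ξ → ξ < L →
    deriv (fun s => deriv (fun s' => u (s', η)) s) ξ
      - deriv (fun s => deriv (fun s' => u (ξ, s')) s) η = (Q ξ - P η) * u (ξ, η)) ∧
  (∀ ξ, 0 < ξ → ξ < L →
    HasDerivWithinAt (fun η => u (ξ, η)) (-h * u (ξ, 0)) (Icc 0 ξ) 0) ∧
  (∀ ξ, 0 ≤ ξ → ξ ≤ L → u (ξ, ξ) = ∫ r in 0..ξ, D r)

lemma exists_isNormalFormSol {Q P D : ℝ → ℝ} (hQ : Continuous Q) (hP : Continuous P)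
    (hD : ContDiff ℝ 1 D) (h : ℝ) {L : ℝ} (hL : 0 < L) : ∃ u, IsNormalFormSol L Q P D h u := by
  obtain ⟨v, h1, h2, h3, h4⟩ := exists_normalForm_solution hQ hP hD h hL
  exact ⟨v, h1.contDiffOn, h2, fun ξ hξ hξ' => (h3 ξ hξ hξ').hasDerivWithinAt, h4⟩

lemma deriv_deriv_sub {f g : ℝ → ℝ} {x : ℝ} (hf : ContDiffAt ℝ 2 f x)
    (hg : ContDiffAt ℝ 2 g x) :
    deriv (fun s => deriv (fun s' => f s' - g s') s) x
      = deriv (fun s => deriv f s) x - deriv (fun s => deriv g s) x := by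
  simpa [iteratedDeriv_succ] using! iteratedDeriv_sub (n := 2) hf hg

lemma IsNormalFormSol.unique {L : ℝ} (hL : 0 < L) {Q P D : ℝ → ℝ} (hQ : Continuous Q)
    (hP : Continuous P) {h : ℝ} {u v : ℝ × ℝ → ℝ} (hu : IsNormalFormSol L Q P D h u)
    (hv : IsNormalFormSol L Q P D h v) : EqOn u v (closedTriangle L) := by
  obtain ⟨u1, u2, u3, u4⟩ := hu
  obtain ⟨v1, v2, v3, v4⟩ := hv
  obtain ⟨C, hC⟩ := (isCompact_closedTriangle L).exists_bound_of_continuousOn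
    (f := fun z => Q z.1 - P z.2) (Continuous.continuousOn (by fun_prop))
  have hC0 : 0 ≤ C := (norm_nonneg _).trans (hC (0, 0) ⟨le_rfl, le_rfl, hL.le⟩)
  have key := eq_zero_of_normalForm (u := fun z => u z - v z) (h := h) hL hC0 (u1.sub v1)
    (fun ξ η h1 h2 h3 => ?_) (fun ξ h1 h2 => ?_) (fun ξ h1 h2 => ?_)
  · exact fun z hz => sub_eq_zero.1 (key z hz)
  · have hn := closedTriangle_mem_nhds h1 h2 h3
    have hcu := u1.contDiffAt hn
    have hcv := v1.contDiffAt hn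
    have hγ₁ : ∀ {w : ℝ × ℝ → ℝ}, ContDiffAt ℝ 2 w (ξ, η) →
        ContDiffAt ℝ 2 (fun s => w (s, η)) ξ := fun hw =>
      hw.comp (f := fun s => (s, η)) ξ (by fun_prop)
    have hγ₂ : ∀ {w : ℝ × ℝ → ℝ}, ContDiffAt ℝ 2 w (ξ, η) →
        ContDiffAt ℝ 2 (fun s => w (ξ, s)) η := fun hw =>
      hw.comp (f := fun s => (ξ, s)) η (by fun_prop)
    rw [deriv_deriv_sub (hγ₁ hcu) (hγ₁ hcv), deriv_deriv_sub (hγ₂ hcu) (hγ₂ hcv)]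
    have hu := u2 ξ η h1 h2 h3
    have hv := v2 ξ η h1 h2 h3
    have hb := mul_le_mul_of_nonneg_right (hC (ξ, η) ⟨h1.le, h2.le, h3.le⟩)
      (abs_nonneg (u (ξ, η) - v (ξ, η)))
    rw [Real.norm_eq_abs, ← abs_mul] at hb
    refine le_of_eq_of_le (congrArg _ ?_) hb
    linear_combination hu - hv
  · exact ((u3 ξ h1 h2).sub (v3 ξ h1 h2)).congr_deriv (by ring)
  · rw [u4 ξ h1 h2, v4 ξ h1 h2, sub_self]

namespace LiouvilleChange

variable {ℓ : ℝ} {a : ℝ → ℝ} (T : LiouvilleChange ℓ a)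

/-- The kernel in the original variables associated with `u`. -/
def pull (u : ℝ × ℝ → ℝ) (x y : ℝ) : ℝ :=
  Real.exp (T.θ x - 3 * T.θ y) * u (T.φ x, T.φ y)

/-- The inverse of `LiouvilleChange.pull`. -/
def push (K : ℝ → ℝ → ℝ) (z : ℝ × ℝ) : ℝ :=
  Real.exp (-(T.θ (T.φ.symm z.1) - 3 * T.θ (T.φ.symm z.2)))
    * K (T.φ.symm z.1) (T.φ.symm z.2)

lemma pull_push (K : ℝ → ℝ → ℝ) : T.pull (T.push K) = K := by
  ext x y
  simp only [pull, push, OrderIso.symm_apply_apply]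
  rw [← mul_assoc, ← Real.exp_add, add_neg_cancel, Real.exp_zero, one_mul]

lemma push_pull (u : ℝ × ℝ → ℝ) : T.push (T.pull u) = u := by
  ext z
  simp only [pull, push, OrderIso.apply_symm_apply]
  rw [← mul_assoc, ← Real.exp_add, neg_add_cancel, Real.exp_zero, one_mul]

lemma contDiffOn_pull_iff {u : ℝ × ℝ → ℝ} :
    ContDiffOn ℝ 2 (fun z : ℝ × ℝ => T.pull u z.1 z.2) (closedTriangle ℓ)
      ↔ ContDiffOn ℝ 2 u (closedTriangle (T.φ ℓ)) := by
  have hθ := T.contDiff_θ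
  have hφ := T.contDiff_φ
  have hψ := T.contDiff_φ_symm
  constructor
  · intro hK
    rw [← T.push_pull u]
    refine ContDiffOn.mul (ContDiff.contDiffOn ?_) (hK.comp
      (g := fun z : ℝ × ℝ => T.pull u z.1 z.2)
      (f := fun z : ℝ × ℝ => (T.φ.symm z.1, T.φ.symm z.2)) (ContDiff.contDiffOn ?_) ?_)
    · fun_prop
    · fun_prop
    · rintro z ⟨h1, h2, h3⟩
      refine ⟨?_, T.φ.symm.monotone h2, ?_⟩
      · rw [← T.φ_nonneg]
        simpa using h1
      · simpa using T.φ.symm.monotone h3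
  · intro hu
    refine ContDiffOn.mul (ContDiff.contDiffOn ?_) (hu.comp
      (f := fun z : ℝ × ℝ => (T.φ z.1, T.φ z.2)) (ContDiff.contDiffOn ?_) ?_)
    · fun_prop
    · fun_prop
    · rintro z ⟨h1, h2, h3⟩
      exact ⟨T.φ_nonneg.2 h1, T.φ.monotone h2, T.φ.monotone h3⟩

lemma pde_pull {u : ℝ × ℝ → ℝ} {x y : ℝ} (h1 : 0 < y) (h2 : y < x) (h3 : x < ℓ)
    (hu : ContDiffAt ℝ 2 u (T.φ x, T.φ y)) :
    a x * deriv (fun s => deriv (fun s' => T.pull u s' y) s) x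
        - deriv (fun s => deriv (fun s' => a s' * T.pull u x s') s) y
      = Real.exp (T.θ x - 3 * T.θ y) * ((T.potential x - T.potential y) * u (T.φ x, T.φ y)
        + (deriv (fun s => deriv (fun s' => u (s', T.φ y)) s) (T.φ x)
          - deriv (fun s => deriv (fun s' => u (T.φ x, s')) s) (T.φ y))) := by
  have e1 : (fun s => deriv (fun s' => T.pull u s' y) s)
      = fun s => Real.exp (-3 * T.θ y)
        * deriv (fun s' => Real.exp (T.θ s') * u (T.φ s', T.φ y)) s := by
    ext s
    rw [← deriv_const_mul_field]
    congr 1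
    ext s'
    rw [pull, ← mul_assoc, ← Real.exp_add]
    ring_nf
  have e2 : (fun s => deriv (fun s' => a s' * T.pull u x s') s)
      =ᶠ[𝓝 y] fun s => Real.exp (T.θ x)
        * deriv (fun s' => Real.exp (T.θ s') * u (T.φ x, T.φ s')) s := by
    filter_upwards [isOpen_Ioo.mem_nhds (⟨h1, h2.trans h3⟩ : y ∈ Ioo 0 ℓ)] with s hs
    rw [← deriv_const_mul_field]
    refine EventuallyEq.deriv_eq ?_
    filter_upwards [isOpen_Ioo.mem_nhds hs] with s' hs'
    rw [pull, T.eq_exp s' (Ioo_subset_Icc_self hs'), ← mul_assoc, ← mul_assoc, ← Real.exp_add,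
      ← Real.exp_add]
    ring_nf
  have hγ₁ : ContDiffAt ℝ 2 (fun s : ℝ => (s, T.φ y)) (T.φ x) := by fun_prop
  have hγ₂ : ContDiffAt ℝ 2 (fun s : ℝ => (T.φ x, s)) (T.φ y) := by fun_prop
  have d1 := T.deriv_deriv_exp_mul_comp (hu.comp (f := fun s => (s, T.φ y)) (T.φ x) hγ₁)
  have d2 := T.deriv_deriv_exp_mul_comp (hu.comp (f := fun s => (T.φ x, s)) (T.φ y) hγ₂)
  simp only [Function.comp_def] at d1 d2
  rw [e1, e2.deriv_eq, deriv_const_mul_field, deriv_const_mul_field, d1, d2,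
    T.eq_exp x ⟨(h1.trans h2).le, h3.le⟩]
  have e3 : Real.exp (T.θ x - 3 * T.θ y)
      = Real.exp (4 * T.θ x) * Real.exp (-3 * T.θ y) * Real.exp (-3 * T.θ x) := by
    rw [← Real.exp_add, ← Real.exp_add]
    ring_nf
  have e4 : Real.exp (T.θ x - 3 * T.θ y) = Real.exp (T.θ x) * Real.exp (-3 * T.θ y) := by
    rw [← Real.exp_add]
    ring_nf
  linear_combination
    -(T.potential x * u (T.φ x, T.φ y) + deriv (deriv fun s => u (s, T.φ y)) (T.φ x)) * e3
    + (T.potential y * u (T.φ x, T.φ y) + deriv (deriv fun s => u (T.φ x, s)) (T.φ y)) * e4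

lemma boundary_pull (hℓ : 0 < ℓ) {u : ℝ × ℝ → ℝ} {x d : ℝ} (hx : 0 < x)
    (hu : HasDerivWithinAt (fun η => u (T.φ x, η)) d (Icc 0 (T.φ x)) 0) :
    a 0 * derivWithin (fun s => T.pull u x s) (Icc 0 x) 0
        + derivWithin a (Icc 0 ℓ) 0 * T.pull u x 0
      = Real.exp (T.θ x - T.θ 0)
        * (d + Real.exp (2 * T.θ 0) * deriv T.θ 0 * u (T.φ x, 0)) := by
  have h0 : (0 : ℝ) ∈ Icc 0 ℓ := ⟨le_rfl, hℓ.le⟩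
  have hcomp : HasDerivWithinAt (fun s => u (T.φ x, T.φ s)) (d * Real.exp (-2 * T.θ 0))
      (Icc 0 x) 0 := by
    rw [← T.map_zero] at hu
    exact hu.comp 0 (T.hasDerivAt_φ 0).hasDerivWithinAt
      fun s hs => ⟨T.φ.monotone hs.1, T.φ.monotone hs.2⟩
  have hd := (((((T.hasDerivAt_θ 0).const_mul 3).const_sub (T.θ x)).exp).hasDerivWithinAt
    (s := Icc 0 x)).mul hcomp
  have hK := hd.derivWithin (uniqueDiffOn_Icc hx 0 ⟨le_rfl, hx.le⟩)
  have ha := (T.hasDerivWithinAt h0).derivWithin (uniqueDiffOn_Icc hℓ 0 h0)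
  rw [ha, T.eq_exp 0 h0]
  refine (congrArg (fun r => Real.exp (4 * T.θ 0) * r + _) hK).trans ?_
  simp only [pull, T.map_zero]
  have e1 : Real.exp (T.θ x - T.θ 0)
      = Real.exp (4 * T.θ 0) * Real.exp (T.θ x - 3 * T.θ 0) * Real.exp (-2 * T.θ 0) := by
    rw [← Real.exp_add, ← Real.exp_add]
    ring_nf
  have e2 : Real.exp (-2 * T.θ 0) * Real.exp (2 * T.θ 0) = 1 := by
    rw [← Real.exp_add, ← Real.exp_zero]
    ring_nf
  rw [e1]
  linear_combination (-(Real.exp (4 * T.θ 0) * Real.exp (T.θ x - 3 * T.θ 0) * deriv T.θ 0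
    * u (T.φ x, 0))) * e2

lemma diagonal_pull {u : ℝ × ℝ → ℝ} {x d : ℝ} (hx : 0 < x) (hxℓ : x < ℓ)
    (hu : HasDerivAt (fun ξ => u (ξ, ξ)) d (T.φ x)) :
    2 * a x * derivWithin (fun s => T.pull u s s) (Icc 0 ℓ) x
      + derivWithin a (Icc 0 ℓ) x * T.pull u x x = 2 * d := by
  have hx' : x ∈ Icc 0 ℓ := ⟨hx.le, hxℓ.le⟩
  have hun := uniqueDiffOn_Icc (hx.trans hxℓ) x hx'
  have hcomp : HasDerivAt (fun s => u (T.φ s, T.φ s)) (d * Real.exp (-2 * T.θ x)) x :=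
    hu.comp x (T.hasDerivAt_φ x)
  have hd := (((T.hasDerivAt_θ x).sub ((T.hasDerivAt_θ x).const_mul 3)).exp).mul hcomp
  have hK := (hd.hasDerivWithinAt (s := Icc 0 ℓ)).derivWithin hun
  have ha := (T.hasDerivWithinAt hx').derivWithin hun
  rw [ha, T.eq_exp x hx']
  refine (congrArg (fun r => 2 * Real.exp (4 * T.θ x) * r + _) hK).trans ?_
  simp only [pull, Pi.sub_apply]
  have e1 : Real.exp (4 * T.θ x) * Real.exp (T.θ x - 3 * T.θ x) * Real.exp (-2 * T.θ x) = 1 := by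
    rw [← Real.exp_add, ← Real.exp_add, ← Real.exp_zero]
    ring_nf
  linear_combination 2 * d * e1

lemma isGoursatSol_pull_iff (hℓ : 0 < ℓ) {p q Q P D : ℝ → ℝ} (hD : Continuous D)
    (hQ : ∀ x ∈ Icc 0 ℓ, Q (T.φ x) = q x - T.potential x)
    (hP : ∀ x ∈ Icc 0 ℓ, P (T.φ x) = p x - T.potential x)
    (hDφ : ∀ x ∈ Icc 0 ℓ, 2 * D (T.φ x) = q x - p x) {u : ℝ × ℝ → ℝ} :
    IsGoursatSol ℓ a p q (T.pull u) ↔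
      IsNormalFormSol (T.φ ℓ) Q P D (Real.exp (2 * T.θ 0) * deriv T.θ 0) u := by
  refine and_congr T.contDiffOn_pull_iff Iff.rfl |>.trans ?_
  refine and_congr_right fun hu => ?_
  have hL : 0 < T.φ ℓ := T.φ_pos.2 hℓ
  refine and_congr ?_ (and_congr ?_ ?_)
  · refine Iff.trans (forall_congr' fun x => ?_) T.φ.surjective.forall.symm
    refine Iff.trans (forall_congr' fun y => ?_) T.φ.surjective.forall.symm
    rw [T.φ_pos, T.φ.lt_iff_lt, T.φ.lt_iff_lt]
    refine forall_congr' fun h1 => forall_congr' fun h2 => forall_congr' fun h3 => ?_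
    have hn := closedTriangle_mem_nhds (T.φ_pos.2 h1) (T.φ.strictMono h2) (T.φ.strictMono h3)
    rw [T.pde_pull h1 h2 h3 (hu.contDiffAt hn), hQ x ⟨(h1.trans h2).le, h3.le⟩,
      hP y ⟨h1.le, (h2.trans h3).le⟩, pull, mul_left_comm,
      mul_right_inj' (Real.exp_pos _).ne']
    constructor <;> intro h <;> linarith
  · refine Iff.trans (forall_congr' fun x => ?_) T.φ.surjective.forall.symm
    rw [T.φ_pos, T.φ.lt_iff_lt]
    refine forall_congr' fun h1 => forall_congr' fun h2 => ?_
    have hx := T.φ_pos.2 h1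
    have hd : DifferentiableWithinAt ℝ (fun η => u (T.φ x, η)) (Icc 0 (T.φ x)) 0 :=
      (hu.differentiableOn two_ne_zero (T.φ x, 0) ⟨le_rfl, hx.le, T.φ.monotone h2.le⟩).comp
        (f := fun η => (T.φ x, η)) 0 (by fun_prop)
        fun η hη => ⟨hη.1, hη.2, T.φ.monotone h2.le⟩
    have hun := uniqueDiffOn_Icc hx 0 ⟨le_rfl, hx.le⟩
    rw [T.boundary_pull hℓ h1 hd.hasDerivWithinAt, mul_eq_zero,
      or_iff_right (Real.exp_pos _).ne']
    constructor
    · intro h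
      exact hd.hasDerivWithinAt.congr_deriv (by linarith)
    · intro h
      rw [h.derivWithin hun]
      ring
  · have hdc : ContDiffOn ℝ 2 (fun ξ => u (ξ, ξ)) (Icc 0 (T.φ ℓ)) :=
      hu.comp (f := fun ξ => (ξ, ξ)) (by fun_prop) fun ξ hξ => ⟨hξ.1, le_rfl, hξ.2⟩
    have hd : ∀ ξ ∈ Ioo 0 (T.φ ℓ), HasDerivAt (fun ξ => u (ξ, ξ))
        (deriv (fun ξ => u (ξ, ξ)) ξ) ξ := fun ξ hξ =>
      ((hdc.contDiffAt (Icc_mem_nhds hξ.1 hξ.2)).differentiableAt two_ne_zero).hasDerivAt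
    have hmem : ∀ {x}, 0 < x → x < ℓ → T.φ x ∈ Ioo 0 (T.φ ℓ) := fun h1 h2 =>
      ⟨T.φ_pos.2 h1, T.φ.strictMono h2⟩
    constructor
    · rintro ⟨hdiag, h0⟩ ξ h1 h2
      have h00 : u (0, 0) = 0 := by
        simpa [pull, T.map_zero, (Real.exp_pos _).ne'] using h0
      have hder : ∀ r ∈ Ioo 0 ξ, HasDerivAt (fun ξ => u (ξ, ξ)) (D r) r := fun r hr => by
        obtain ⟨x, rfl⟩ := T.φ.surjective r
        have hx1 := T.φ_pos.1 hr.1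
        have hx2 : x < ℓ := T.φ.lt_iff_lt.1 (hr.2.trans_le h2)
        refine (hd _ (hmem hx1 hx2)).congr_deriv ?_
        have e1 := hdiag x hx1 hx2
        rw [T.diagonal_pull hx1 hx2 (hd _ (hmem hx1 hx2))] at e1
        linarith [hDφ x ⟨hx1.le, hx2.le⟩]
      rw [integral_eq_sub_of_hasDerivAt_of_le h1
        (hdc.continuousOn.mono (Icc_subset_Icc_right h2)) hder (hD.intervalIntegrable _ _), h00,
        sub_zero]
    · intro hprim
      refine ⟨fun x h1 h2 => ?_, ?_⟩
      · have hev : (fun ξ => u (ξ, ξ)) =ᶠ[𝓝 (T.φ x)] fun ξ => ∫ r in 0..ξ, D r := by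
          filter_upwards [isOpen_Ioo.mem_nhds (hmem h1 h2)] with ξ hξ
            using hprim ξ hξ.1.le hξ.2.le
        rw [T.diagonal_pull h1 h2 ((hD.integral_hasStrictDerivAt 0
          (T.φ x)).hasDerivAt.congr_of_eventuallyEq hev), hDφ x ⟨h1.le, h2.le⟩]
      · rw [pull, T.map_zero, hprim 0 le_rfl hL.le, integral_same, mul_zero]

end LiouvilleChange

/-- Existence and uniqueness for the Goursat problem (Lemma 1):
there is a solution, and any two solutions agree on the closed triangle. -/
theorem stmt_4
    (ℓ : ℝ) (hℓ : 0 < ℓ)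
    (p q a : ℝ → ℝ)
    (hp : ContDiffOn ℝ 1 p (Icc 0 ℓ)) (hq : ContDiffOn ℝ 1 q (Icc 0 ℓ))
    (ha : ContDiffOn ℝ 2 a (Icc 0 ℓ)) (hapos : ∀ x ∈ Icc (0:ℝ) ℓ, 0 < a x) :
    ∃ K : ℝ → ℝ → ℝ, IsGoursatSol ℓ a p q K ∧
      ∀ K' : ℝ → ℝ → ℝ, IsGoursatSol ℓ a p q K' →
        ∀ x y : ℝ, 0 ≤ y → y ≤ x → x ≤ ℓ → K' x y = K x y := by
  obtain ⟨T⟩ := LiouvilleChange.nonempty hℓ ha hapos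
  obtain ⟨p', hp', hpp⟩ := ContDiffOn.exists_contDiff_extension hℓ 1 (by exact_mod_cast hp)
  obtain ⟨q', hq', hqq⟩ := ContDiffOn.exists_contDiff_extension hℓ 1 (by exact_mod_cast hq)
  have hψ := T.contDiff_φ_symm
  have hψ1 : ContDiff ℝ 1 T.φ.symm := hψ.of_le (by norm_num)
  have hr := T.continuous_potential
  set Q : ℝ → ℝ := fun ξ => q' (T.φ.symm ξ) - T.potential (T.φ.symm ξ) with hQdef
  set P : ℝ → ℝ := fun ξ => p' (T.φ.symm ξ) - T.potential (T.φ.symm ξ) with hPdef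
  set D : ℝ → ℝ := fun ξ => (q' (T.φ.symm ξ) - p' (T.φ.symm ξ)) / 2 with hDdef
  have hQ : Continuous Q :=
    (hq'.continuous.comp hψ.continuous).sub (hr.comp hψ.continuous)
  have hP : Continuous P :=
    (hp'.continuous.comp hψ.continuous).sub (hr.comp hψ.continuous)
  have hD : ContDiff ℝ 1 D := ((hq'.comp hψ1).sub (hp'.comp hψ1)).div_const 2
  have hL : 0 < T.φ ℓ := T.φ_pos.2 hℓ
  have hiff : ∀ u, IsGoursatSol ℓ a p q (T.pull u) ↔
      IsNormalFormSol (T.φ ℓ) Q P D (Real.exp (2 * T.θ 0) * deriv T.θ 0) u := fun u =>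
    T.isGoursatSol_pull_iff hℓ hD.continuous
      (fun x hx => by simp [hQdef, hqq hx]) (fun x hx => by simp [hPdef, hpp hx])
      fun x hx => by simp [hDdef, hqq hx, hpp hx, mul_div_cancel₀]
  obtain ⟨u, hu⟩ := exists_isNormalFormSol hQ hP hD
    (Real.exp (2 * T.θ 0) * deriv T.θ 0) hL
  refine ⟨T.pull u, (hiff u).2 hu, fun K' hK' x y h1 h2 h3 => ?_⟩
  rw [← T.pull_push K'] at hK' ⊢
  have := ((hiff _).1 hK').unique hL hQ hP hu
    (show (T.φ x, T.φ y) ∈ closedTriangle (T.φ ℓ) from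
      ⟨T.φ_nonneg.2 h1, T.φ.monotone h2, T.φ.monotone h3⟩)
  rw [LiouvilleChange.pull, this, LiouvilleChange.pull]
end
end

section
/- Let σ ∈ ℂ\{0}, p ∈ C¹([0,ℓ];ℝ), a ∈ C²([0,ℓ];ℝ) with a > 0 on [0,ℓ]. Let z ∈ C^{1,2}([0,T]×[0,ℓ];ℂ) satisfy σ∂_t z − a(x)∂_x²z + p(x)z = 0 in (0,T)×(0,ℓ) and z(t,0) = ∂_x z(t,0) = 0 for 0 < t < T. Then z ≡ 0 on [0,T]×[0,ℓ] (unique continuation from the lateral Cauchy data at x = 0). -/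
open Set MeasureTheory intervalIntegral

noncomputable section

/-- `u` is of class `C^{1,2}` on `[0,T] × [0,ℓ]`, with `ut`, `ux`, `uxx` its
partial derivatives `∂ₜu`, `∂ₓu`, `∂ₓ²u`. -/
def IsC12 (T ℓ : ℝ) (u ut ux uxx : ℝ → ℝ → ℂ) : Prop :=
  (∀ t ∈ Icc (0:ℝ) T, ∀ x ∈ Icc (0:ℝ) ℓ,
      HasDerivWithinAt (fun s => u s x) (ut t x) (Icc 0 T) t ∧
      HasDerivWithinAt (fun y => u t y) (ux t x) (Icc 0 ℓ) x ∧
      HasDerivWithinAt (fun y => ux t y) (uxx t x) (Icc 0 ℓ) x) ∧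
  ContinuousOn (fun z : ℝ × ℝ => u z.1 z.2) (Icc 0 T ×ˢ Icc 0 ℓ) ∧
  ContinuousOn (fun z : ℝ × ℝ => ut z.1 z.2) (Icc 0 T ×ˢ Icc 0 ℓ) ∧
  ContinuousOn (fun z : ℝ × ℝ => ux z.1 z.2) (Icc 0 T ×ˢ Icc 0 ℓ) ∧
  ContinuousOn (fun z : ℝ × ℝ => uxx z.1 z.2) (Icc 0 T ×ˢ Icc 0 ℓ)

open Polynomial in
/-- The polynomial `(t - α)^m (β - t)^n`. -/
def endpointPoly (α β : ℝ) (m n : ℕ) : ℝ[X] := (X - C α) ^ m * (C β - X) ^ n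

open Polynomial in
theorem derivative_endpointPoly (α β : ℝ) (m n : ℕ) :
    derivative (endpointPoly α β m n) =
      C (m : ℝ) * endpointPoly α β (m - 1) n - C (n : ℝ) * endpointPoly α β m (n - 1) := by
  simp only [endpointPoly, derivative_mul, derivative_pow, derivative_sub, derivative_X,
    derivative_C]
  ring

open Polynomial in
theorem abs_eval_iterate_derivative_endpointPoly_le {α β L t : ℝ} (hL : 1 ≤ L)
    (hαβ : β - α ≤ L) (ht : t ∈ Icc α β) (k m n : ℕ) :
    |(derivative^[k] (endpointPoly α β m n)).eval t| ≤ ((m + n : ℕ) : ℝ) ^ k * L ^ (m + n) := by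
  induction k generalizing m n with
  | zero =>
    simp only [Function.iterate_zero, id, endpointPoly, eval_mul, eval_pow, eval_sub, eval_X,
      eval_C, abs_mul, abs_pow, pow_zero, one_mul, pow_add]
    have h1 : |t - α| ≤ L := by rw [abs_of_nonneg (by linarith [ht.1])]; linarith [ht.2]
    have h2 : |β - t| ≤ L := by rw [abs_of_nonneg (by linarith [ht.2])]; linarith [ht.1]
    gcongr
  | succ k ih =>
    rw [Function.iterate_succ_apply, derivative_endpointPoly, iterate_derivative_sub,
      iterate_derivative_C_mul, iterate_derivative_C_mul]
    simp only [eval_sub, eval_mul, eval_C]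
    have key : ∀ i j : ℕ, i ≤ m → j ≤ n →
        |(derivative^[k] (endpointPoly α β i j)).eval t|
          ≤ ((m + n : ℕ) : ℝ) ^ k * L ^ (m + n) := fun i j hi hj => by
      refine (ih i j).trans ?_
      gcongr
    refine (abs_sub _ _).trans ?_
    rw [abs_mul, abs_mul, Nat.abs_cast, Nat.abs_cast]
    calc _ ≤ (m : ℝ) * (((m + n : ℕ) : ℝ) ^ k * L ^ (m + n))
          + n * (((m + n : ℕ) : ℝ) ^ k * L ^ (m + n)) := by
          gcongr
          · exact key _ _ (by omega) le_rfl
          · exact key _ _ le_rfl (by omega)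
      _ = _ := by push_cast; ring

open Polynomial in
theorem eval_iterate_derivative_endpointPoly_left (α β : ℝ) {k m : ℕ} (n : ℕ) (hk : k < m) :
    (derivative^[k] (endpointPoly α β m n)).eval α = 0 := by
  obtain ⟨q, hq⟩ := pow_sub_dvd_iterate_derivative_of_pow_dvd k
    (Dvd.intro _ rfl : (X - C α) ^ m ∣ endpointPoly α β m n)
  rw [hq]
  simp [Nat.sub_ne_zero_of_lt hk]

open Polynomial in
theorem eval_iterate_derivative_endpointPoly_right (α β : ℝ) {k n : ℕ} (m : ℕ) (hk : k < n) :
    (derivative^[k] (endpointPoly α β m n)).eval β = 0 := by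
  obtain ⟨q, hq⟩ := pow_sub_dvd_iterate_derivative_of_pow_dvd k
    (Dvd.intro_left _ rfl : (C β - X) ^ n ∣ endpointPoly α β m n)
  rw [hq]
  simp [Nat.sub_ne_zero_of_lt hk]

theorem integral_sub_mul_pow_div_factorial (x : ℝ) (n : ℕ) :
    ∫ y in (0:ℝ)..x, (x - y) * (y ^ n / n.factorial) = x ^ (n + 2) / (n + 2).factorial := by
  have h : ∀ y : ℝ, (x - y) * (y ^ n / n.factorial) =
      x / n.factorial * y ^ n - 1 / n.factorial * y ^ (n + 1) := fun y => by ring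
  simp_rw [h]
  rw [intervalIntegral.integral_sub (Continuous.intervalIntegrable (by fun_prop) _ _)
      (Continuous.intervalIntegrable (by fun_prop) _ _),
    intervalIntegral.integral_const_mul, intervalIntegral.integral_const_mul,
    integral_pow, integral_pow]
  have : (n.factorial : ℝ) ≠ 0 := by positivity
  simp only [Nat.factorial_succ]
  push_cast
  field_simp
  ring

/-- Iterated estimate for a chain of functions with `(I k)'' = G k` and
`‖G k‖ ≤ K (‖I k‖ + ‖I (k+1)‖)`, with zero Cauchy data at `0`. -/
theorem norm_chain_le {ℓ K B : ℝ} (hK : 0 ≤ K) (N : ℕ) (I G : ℕ → ℝ → ℂ)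
    (hI : ∀ k < N, ∀ x ∈ Ioo 0 ℓ, I k x = ∫ y in (0:ℝ)..x, ((x - y : ℝ) : ℂ) * G k y)
    (hG : ∀ k < N, ∀ y ∈ Ioo 0 ℓ, ‖G k y‖ ≤ K * (‖I k y‖ + ‖I (k + 1) y‖))
    (hB : ∀ k ≤ N, ∀ x ∈ Ioo 0 ℓ, ‖I k x‖ ≤ B) (n k : ℕ) (hkn : k + n ≤ N)
    (x : ℝ) (hx : x ∈ Ioo 0 ℓ) :
    ‖I k x‖ ≤ B * (2 * K) ^ n * (x ^ (2 * n) / (2 * n).factorial) := by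
  induction n generalizing k x with
  | zero => simpa using hB k hkn x hx
  | succ n ih =>
    rw [hI k (by omega) x hx]
    have hbound : ∀ y ∈ Ioc 0 x, ‖((x - y : ℝ) : ℂ) * G k y‖ ≤
        B * (2 * K) ^ (n + 1) * ((x - y) * (y ^ (2 * n) / (2 * n).factorial)) := by
      intro y hy
      have hy' : y ∈ Ioo 0 ℓ := ⟨hy.1, hy.2.trans_lt hx.2⟩
      have h0 : 0 ≤ x - y := by linarith [hy.2]
      rw [norm_mul, Complex.norm_real, Real.norm_of_nonneg h0]
      have h1 := ih k (by omega) y hy'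
      have h2 := ih (k + 1) (by omega) y hy'
      calc (x - y) * ‖G k y‖
          ≤ (x - y) * (K * (B * (2 * K) ^ n * (y ^ (2 * n) / (2 * n).factorial)
            + B * (2 * K) ^ n * (y ^ (2 * n) / (2 * n).factorial))) := by
            gcongr
            refine (hG k (by omega) y hy').trans ?_
            gcongr
        _ = _ := by ring
    refine (intervalIntegral.norm_integral_le_of_norm_le hx.1.le (Filter.Eventually.of_forall hbound)
      (Continuous.intervalIntegrable (by fun_prop) _ _)).trans_eq ?_
    rw [intervalIntegral.integral_const_mul, integral_sub_mul_pow_div_factorial]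
    rfl

/-- Second-order Taylor formula at `0` for a function with zero Cauchy data there. -/
theorem eq_integral_sub_mul_of_hasDerivWithinAt {ℓ : ℝ} {u u' u'' : ℝ → ℂ}
    (hu : ∀ x ∈ Icc 0 ℓ, HasDerivWithinAt u (u' x) (Icc 0 ℓ) x)
    (hu' : ∀ x ∈ Icc 0 ℓ, HasDerivWithinAt u' (u'' x) (Icc 0 ℓ) x)
    (hcont : ContinuousOn u'' (Icc 0 ℓ)) (h0 : u 0 = 0) (h0' : u' 0 = 0)
    {x : ℝ} (hx : x ∈ Ioo 0 ℓ) :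
    u x = ∫ y in (0:ℝ)..x, ((x - y : ℝ) : ℂ) * u'' y := by
  have hsub : Icc 0 x ⊆ Icc 0 ℓ := Icc_subset_Icc_right hx.2.le
  have hcu : ContinuousOn u (Icc 0 x) := fun y hy => (hu y (hsub hy)).continuousWithinAt.mono hsub
  have hcu' : ContinuousOn u' (Icc 0 x) :=
    fun y hy => (hu' y (hsub hy)).continuousWithinAt.mono hsub
  have hw : Continuous fun y : ℝ => ((x - y : ℝ) : ℂ) := by fun_prop
  rw [integral_eq_sub_of_hasDerivAt_of_le (f := fun y => ((x - y : ℝ) : ℂ) * u' y + u y) hx.1.le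
    ((hw.continuousOn.mul hcu').add hcu)]
  · simp [h0, h0']
  · intro y hy
    have hmem : Icc 0 ℓ ∈ nhds y := Icc_mem_nhds hy.1 (hy.2.trans hx.2)
    have hyl := hsub (Ioo_subset_Icc_self hy)
    have hd : HasDerivAt (fun y : ℝ => ((x - y : ℝ) : ℂ)) ((-1 : ℝ) : ℂ) y :=
      ((hasDerivAt_id y).const_sub x).ofReal_comp
    refine ((hd.mul ((hu' y hyl).hasDerivAt hmem)).add ((hu y hyl).hasDerivAt hmem)).congr_deriv ?_
    push_cast
    ring
  · exact (hw.continuousOn.mul (hcont.mono hsub)).intervalIntegrable_of_Icc hx.1.le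

section Moments

open Polynomial

theorem continuousOn_slice_time {T ℓ x : ℝ} {u : ℝ → ℝ → ℂ}
    (hu : ContinuousOn (fun z : ℝ × ℝ => u z.1 z.2) (Icc 0 T ×ˢ Icc 0 ℓ)) (hx : x ∈ Icc 0 ℓ) :
    ContinuousOn (fun t => u t x) (Icc 0 T) :=
  hu.comp (f := fun t : ℝ => (t, x)) (by fun_prop) fun _ ht => ⟨ht, hx⟩

theorem continuousOn_slice_space {T ℓ t : ℝ} {u : ℝ → ℝ → ℂ}
    (hu : ContinuousOn (fun z : ℝ × ℝ => u z.1 z.2) (Icc 0 T ×ˢ Icc 0 ℓ)) (ht : t ∈ Icc 0 T) :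
    ContinuousOn (fun x => u t x) (Icc 0 ℓ) :=
  hu.comp (f := fun x : ℝ => (t, x)) (by fun_prop) fun _ hx => ⟨ht, hx⟩

theorem continuous_ofReal_eval (Q : ℝ[X]) : Continuous fun t : ℝ => ((Q.eval t : ℝ) : ℂ) :=
  Complex.continuous_ofReal.comp Q.continuous

variable {T ℓ α β : ℝ} {z zt zx zxx : ℝ → ℝ → ℂ}

theorem integral_mul_eval_eq_integral_sub_mul (hz : IsC12 T ℓ z zt zx zxx)
    (hcauchy : ∀ t ∈ Ioo (0:ℝ) T, z t 0 = 0 ∧ zx t 0 = 0)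
    (hα : 0 < α) (hαβ : α ≤ β) (hβ : β < T) (Q : ℝ[X]) {x : ℝ} (hx : x ∈ Ioo 0 ℓ) :
    ∫ t in α..β, z t x * (Q.eval t : ℝ) =
      ∫ y in (0:ℝ)..x, ((x - y : ℝ) : ℂ) * ∫ t in α..β, zxx t y * (Q.eval t : ℝ) := by
  obtain ⟨hd, -, -, -, hcxx⟩ := hz
  have hQ := continuous_ofReal_eval Q
  have htaylor : ∀ t ∈ Icc α β, z t x * (Q.eval t : ℝ) =
      ∫ y in (0:ℝ)..x, ((x - y : ℝ) : ℂ) * (zxx t y * (Q.eval t : ℝ)) := by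
    intro t ht
    have ht' : t ∈ Ioo 0 T := ⟨hα.trans_le ht.1, ht.2.trans_lt hβ⟩
    have htT := Ioo_subset_Icc_self ht'
    rw [eq_integral_sub_mul_of_hasDerivWithinAt (fun y hy => (hd t htT y hy).2.1)
      (fun y hy => (hd t htT y hy).2.2) (continuousOn_slice_space hcxx htT) (hcauchy t ht').1
      (hcauchy t ht').2 hx, ← intervalIntegral.integral_mul_const]
    simp_rw [mul_assoc]
  rw [intervalIntegral.integral_congr (by rw [uIcc_of_le hαβ]; exact htaylor),
    intervalIntegral_intervalIntegral_swap]
  · simp_rw [intervalIntegral.integral_const_mul]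
  · have hc : ContinuousOn (Function.uncurry fun t y : ℝ =>
        ((x - y : ℝ) : ℂ) * (zxx t y * (Q.eval t : ℝ))) (Icc α β ×ˢ Icc 0 x) := by
      have h1 : Continuous fun q : ℝ × ℝ => ((x - q.2 : ℝ) : ℂ) := by fun_prop
      exact h1.continuousOn.mul ((hcxx.mono (prod_mono (Icc_subset_Icc hα.le hβ.le)
        (Icc_subset_Icc_right hx.2.le))).mul (hQ.comp continuous_fst).continuousOn)
    refine (hc.integrableOn_compact (isCompact_Icc.prod isCompact_Icc)).mono_set ?_
    rw [uIoc_of_le hαβ, uIoc_of_le hx.1.le]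
    exact prod_mono Ioc_subset_Icc_self Ioc_subset_Icc_self

theorem integral_deriv_mul_eval (hz : IsC12 T ℓ z zt zx zxx)
    (hα : 0 < α) (hαβ : α ≤ β) (hβ : β < T) {Q : ℝ[X]} (hQα : Q.eval α = 0) (hQβ : Q.eval β = 0)
    {x : ℝ} (hx : x ∈ Icc 0 ℓ) :
    ∫ t in α..β, zt t x * (Q.eval t : ℝ) =
      -∫ t in α..β, z t x * ((derivative Q).eval t : ℝ) := by
  obtain ⟨hd, -, hct, -, -⟩ := hz
  have hsub : Icc α β ⊆ Icc 0 T := Icc_subset_Icc hα.le hβ.le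
  rw [integral_mul_deriv_eq_deriv_mul_of_hasDerivWithinAt (u := fun t => z t x)
    (u' := fun t => zt t x) (v := fun t => ((Q.eval t : ℝ) : ℂ))]
  · simp [hQα, hQβ]
  · rw [uIcc_of_le hαβ]
    exact fun t ht => (hd t (hsub ht) x hx).1.mono hsub
  · exact fun t _ => (Q.hasDerivAt t).ofReal_comp.hasDerivWithinAt
  · exact ((continuousOn_slice_time hct hx).mono hsub).intervalIntegrable_of_Icc hαβ
  · exact (continuous_ofReal_eval _).intervalIntegrable _ _

theorem norm_integral_deriv2_mul_eval_le (hz : IsC12 T ℓ z zt zx zxx) {σ : ℂ} {p a : ℝ → ℝ} {K : ℝ}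
    (hpde : ∀ t ∈ Ioo (0:ℝ) T, ∀ x ∈ Ioo (0:ℝ) ℓ,
      σ * zt t x - a x * zxx t x + p x * z t x = 0)
    (hα : 0 < α) (hαβ : α ≤ β) (hβ : β < T) {Q : ℝ[X]} (hQα : Q.eval α = 0) (hQβ : Q.eval β = 0)
    {x : ℝ} (hx : x ∈ Ioo 0 ℓ) (hax : a x ≠ 0)
    (hKσ : ‖σ / a x‖ ≤ K) (hKp : |p x / a x| ≤ K) :
    ‖∫ t in α..β, zxx t x * (Q.eval t : ℝ)‖ ≤
      K * (‖∫ t in α..β, z t x * (Q.eval t : ℝ)‖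
        + ‖∫ t in α..β, z t x * ((derivative Q).eval t : ℝ)‖) := by
  have hx' := Ioo_subset_Icc_self hx
  have hac : (a x : ℂ) ≠ 0 := by exact_mod_cast hax
  have hsub : Icc α β ⊆ Icc 0 T := Icc_subset_Icc hα.le hβ.le
  have hQ := continuous_ofReal_eval Q
  have hint : ∀ {u : ℝ → ℝ → ℂ},
      ContinuousOn (fun z : ℝ × ℝ => u z.1 z.2) (Icc 0 T ×ˢ Icc 0 ℓ) →
      IntervalIntegrable (fun t => u t x * (Q.eval t : ℝ)) volume α β := fun hu =>
    (((continuousOn_slice_time hu hx').mono hsub).mul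
      hQ.continuousOn).intervalIntegrable_of_Icc hαβ
  have heq : ∀ t ∈ Icc α β, zxx t x * (Q.eval t : ℝ) =
      ((p x / a x : ℝ) : ℂ) * (z t x * (Q.eval t : ℝ))
        + σ / a x * (zt t x * (Q.eval t : ℝ)) := by
    intro t ht
    have h := hpde t ⟨hα.trans_le ht.1, ht.2.trans_lt hβ⟩ x hx
    have hs : zxx t x = (σ * zt t x + p x * z t x) / a x := by
      rw [eq_div_iff hac]
      linear_combination -h
    rw [hs]
    push_cast
    ring
  rw [intervalIntegral.integral_congr (by rw [uIcc_of_le hαβ]; exact heq),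
    intervalIntegral.integral_add ((hint hz.2.1).const_mul _) ((hint hz.2.2.1).const_mul _),
    intervalIntegral.integral_const_mul, intervalIntegral.integral_const_mul,
    integral_deriv_mul_eval hz hα hαβ hβ hQα hQβ hx', mul_add]
  refine (norm_add_le _ _).trans ?_
  rw [norm_mul, norm_mul, norm_neg, Complex.norm_real, Real.norm_eq_abs]
  gcongr

/-- Moments of the solution against `(t - α)^N (β - t)^N` are super-exponentially small. -/
theorem norm_integral_mul_endpointPoly_le (hz : IsC12 T ℓ z zt zx zxx) {σ : ℂ} {p a : ℝ → ℝ}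
    {K L M : ℝ}
    (hpde : ∀ t ∈ Ioo (0:ℝ) T, ∀ x ∈ Ioo (0:ℝ) ℓ,
      σ * zt t x - a x * zxx t x + p x * z t x = 0)
    (hcauchy : ∀ t ∈ Ioo (0:ℝ) T, z t 0 = 0 ∧ zx t 0 = 0)
    (hα : 0 < α) (hαβ : α ≤ β) (hβ : β < T) (hL : 1 ≤ L) (hβαL : β - α ≤ L) (hK : 0 ≤ K)
    (ha0 : ∀ x ∈ Ioo 0 ℓ, a x ≠ 0) (hKσ : ∀ x ∈ Ioo 0 ℓ, ‖σ / a x‖ ≤ K)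
    (hKp : ∀ x ∈ Ioo 0 ℓ, |p x / a x| ≤ K)
    (hM : ∀ t ∈ Icc 0 T, ∀ x ∈ Icc 0 ℓ, ‖z t x‖ ≤ M)
    {N : ℕ} (hN : 1 ≤ N) {x : ℝ} (hx : x ∈ Ioo 0 ℓ) :
    ‖∫ t in α..β, z t x * ((endpointPoly α β N N).eval t : ℝ)‖ ≤
      M * (β - α) * (4 * K * L ^ 2 * x ^ 2) ^ N / N.factorial := by
  have hM0 : 0 ≤ M := (norm_nonneg _).trans
    (hM α ⟨hα.le, hαβ.trans hβ.le⟩ x (Ioo_subset_Icc_self hx))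
  have hN1 : (1 : ℝ) ≤ ((N + N : ℕ) : ℝ) := by exact_mod_cast (by omega : 1 ≤ N + N)
  have hmain := norm_chain_le (ℓ := ℓ)
    (B := M * (((N + N : ℕ) : ℝ) ^ N * L ^ (N + N)) * (β - α)) hK N
    (fun k x => ∫ t in α..β, z t x * ((derivative^[k] (endpointPoly α β N N)).eval t : ℝ))
    (fun k x => ∫ t in α..β, zxx t x * ((derivative^[k] (endpointPoly α β N N)).eval t : ℝ))
    (fun k _ x hx => integral_mul_eval_eq_integral_sub_mul hz hcauchy hα hαβ hβ _ hx)
    (fun k hk y hy => by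
      simp only [Function.iterate_succ_apply']
      exact norm_integral_deriv2_mul_eval_le hz hpde hα hαβ hβ
        (eval_iterate_derivative_endpointPoly_left α β N hk)
        (eval_iterate_derivative_endpointPoly_right α β N hk) hy (ha0 y hy) (hKσ y hy) (hKp y hy))
    (fun k hk y hy => by
      refine (intervalIntegral.norm_integral_le_of_norm_le_const
        (C := M * (((N + N : ℕ) : ℝ) ^ N * L ^ (N + N))) fun t ht => ?_).trans_eq
        (by rw [abs_of_nonneg (sub_nonneg.2 hαβ)])
      rw [uIoc_of_le hαβ] at ht
      have ht' := Ioc_subset_Icc_self ht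
      rw [norm_mul, Complex.norm_real, Real.norm_eq_abs]
      gcongr
      · exact hM t (Icc_subset_Icc hα.le hβ.le ht') y (Ioo_subset_Icc_self hy)
      · refine (abs_eval_iterate_derivative_endpointPoly_le hL hβαL ht' k N N).trans ?_
        gcongr)
    N 0 (by omega) x hx
  refine hmain.trans ?_
  have hfac : (N.factorial : ℝ) * (N : ℝ) ^ N ≤ ((2 * N).factorial : ℝ) := by
    have h1 : N.factorial * N ^ N ≤ (2 * N).factorial := by
      rw [two_mul]
      exact (Nat.mul_le_mul_left _ (Nat.pow_le_pow_left (Nat.le_succ N) N)).trans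
        Nat.factorial_mul_pow_le_factorial
    exact_mod_cast h1
  have hNpos : (0:ℝ) < N := by exact_mod_cast hN
  have hβα : 0 ≤ β - α := sub_nonneg.2 hαβ
  have hxpos := hx.1
  have hLpos : 0 < L := by linarith
  calc _ = M * (β - α) * ((4 * K * L ^ 2 * x ^ 2) ^ N * (N : ℝ) ^ N) / (2 * N).factorial := by
        push_cast
        rw [← two_mul, ← two_mul, pow_mul, pow_mul, show (4 : ℝ) = 2 * 2 by norm_num]
        simp only [mul_pow]
        ring
    _ ≤ M * (β - α) * ((4 * K * L ^ 2 * x ^ 2) ^ N * (N : ℝ) ^ N)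
          / (N.factorial * (N : ℝ) ^ N) := by
        gcongr
    _ = _ := by
        have := pow_ne_zero N hNpos.ne'
        field_simp

end Moments

theorem endpointPoly_eval (α β t : ℝ) (m n : ℕ) :
    (endpointPoly α β m n).eval t = (t - α) ^ m * (β - t) ^ n := by
  simp [endpointPoly]

theorem le_integral_endpointPoly {t₀ δ : ℝ} (hδ : 0 < δ) (N : ℕ) :
    δ * ((δ / 2) ^ 2) ^ N ≤
      ∫ t in (t₀ - δ)..(t₀ + δ), (endpointPoly (t₀ - δ) (t₀ + δ) N N).eval t := by
  have hc : Continuous fun t => (endpointPoly (t₀ - δ) (t₀ + δ) N N).eval t :=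
    Polynomial.continuous _
  have h1 : ∫ _ in (t₀ - δ / 2)..(t₀ + δ / 2), ((δ / 2) ^ 2) ^ N ≤
      ∫ t in (t₀ - δ / 2)..(t₀ + δ / 2), (endpointPoly (t₀ - δ) (t₀ + δ) N N).eval t := by
    refine intervalIntegral.integral_mono_on (by linarith) (by simp) (hc.intervalIntegrable _ _)
      fun t ht => ?_
    rw [endpointPoly_eval, ← mul_pow, sq]
    gcongr
    · linarith [ht.1]
    · linarith [ht.1]
    · linarith [ht.2]
  refine le_trans (le_of_eq ?_) (h1.trans ?_)
  · rw [intervalIntegral.integral_const, smul_eq_mul]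
    ring
  · refine intervalIntegral.integral_mono_interval (by linarith) (by linarith) (by linarith) ?_
      (hc.intervalIntegrable _ _)
    filter_upwards [ae_restrict_mem measurableSet_Ioc] with t ht
    rw [endpointPoly_eval]
    have := sub_nonneg.2 ht.1.le
    have := sub_nonneg.2 ht.2
    positivity

/-- If `u` stays within `‖c‖ / 2` of `c`, its weighted integrals are at least half of those
of `c`. -/
theorem le_norm_integral_mul_of_norm_sub_le {α β : ℝ} (hαβ : α ≤ β) {u : ℝ → ℂ} {f : ℝ → ℝ} {c : ℂ}
    (hu : ContinuousOn u (Icc α β)) (hf : Continuous f) (hf0 : ∀ t ∈ Icc α β, 0 ≤ f t)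
    (huc : ∀ t ∈ Icc α β, ‖u t - c‖ ≤ ‖c‖ / 2) :
    ‖c‖ / 2 * ∫ t in α..β, f t ≤ ‖∫ t in α..β, u t * (f t : ℂ)‖ := by
  have hfc : Continuous fun t => (f t : ℂ) := Complex.continuous_ofReal.comp hf
  have h1 : ‖∫ t in α..β, (u t - c) * (f t : ℂ)‖ ≤ ∫ t in α..β, ‖c‖ / 2 * f t := by
    refine intervalIntegral.norm_integral_le_of_norm_le hαβ
      (Filter.Eventually.of_forall fun t ht => ?_)
      (Continuous.intervalIntegrable (by fun_prop) _ _)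
    have ht' := Ioc_subset_Icc_self ht
    rw [norm_mul, Complex.norm_real, Real.norm_of_nonneg (hf0 t ht')]
    exact mul_le_mul_of_nonneg_right (huc t ht') (hf0 t ht')
  have h2 : ∫ t in α..β, (u t - c) * (f t : ℂ) =
      (∫ t in α..β, u t * (f t : ℂ)) - c * ((∫ t in α..β, f t : ℝ) : ℂ) := by
    simp_rw [sub_mul]
    rw [← intervalIntegral.integral_ofReal, ← intervalIntegral.integral_const_mul]
    exact intervalIntegral.integral_sub
      ((hu.mul hfc.continuousOn).intervalIntegrable_of_Icc hαβ)
      (Continuous.intervalIntegrable (by fun_prop) _ _)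
  have h3 : 0 ≤ ∫ t in α..β, f t := intervalIntegral.integral_nonneg hαβ hf0
  have h4 : ‖c * ((∫ t in α..β, f t : ℝ) : ℂ)‖ = ‖c‖ * ∫ t in α..β, f t := by
    rw [norm_mul, Complex.norm_real, Real.norm_of_nonneg h3]
  rw [intervalIntegral.integral_const_mul, h2] at h1
  have h5 := norm_sub_norm_le (c * ((∫ t in α..β, f t : ℝ) : ℂ)) (∫ t in α..β, u t * (f t : ℂ))
  rw [norm_sub_rev, h4] at h5
  linarith

/-- Unique continuation (Lemma 3): a solution of `σ∂ₜz − a∂ₓ²z + pz = 0` with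
vanishing Cauchy data `z(t,0) = ∂ₓz(t,0) = 0` on `(0,T)` vanishes identically. -/
theorem stmt_6
    (T ℓ : ℝ) (hT : 0 < T) (hℓ : 0 < ℓ)
    (σ : ℂ) (hσ : σ ≠ 0)
    (p a : ℝ → ℝ)
    (hp : ContDiffOn ℝ 1 p (Icc 0 ℓ))
    (ha : ContDiffOn ℝ 2 a (Icc 0 ℓ)) (hapos : ∀ x ∈ Icc (0:ℝ) ℓ, 0 < a x)
    (z zt zx zxx : ℝ → ℝ → ℂ) (hz : IsC12 T ℓ z zt zx zxx)
    (hpde : ∀ t ∈ Ioo (0:ℝ) T, ∀ x ∈ Ioo (0:ℝ) ℓ,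
      σ * zt t x - a x * zxx t x + p x * z t x = 0)
    (hcauchy : ∀ t ∈ Ioo (0:ℝ) T, z t 0 = 0 ∧ zx t 0 = 0) :
    ∀ t ∈ Icc (0:ℝ) T, ∀ x ∈ Icc (0:ℝ) ℓ, z t x = 0 := by
  have hinterior : ∀ t ∈ Ioo (0:ℝ) T, ∀ x ∈ Ioo (0:ℝ) ℓ, z t x = 0 := by
    intro t₀ ht₀ x hx
    by_contra hne
    have hx' := Ioo_subset_Icc_self hx
    have ha0 : ∀ y ∈ Icc (0:ℝ) ℓ, a y ≠ 0 := fun y hy => (hapos y hy).ne'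
    obtain ⟨K₁, hK₁⟩ := isCompact_Icc.exists_bound_of_continuousOn
      (f := fun y => p y / a y) (hp.continuousOn.div ha.continuousOn ha0)
    obtain ⟨K₂, hK₂⟩ := isCompact_Icc.exists_bound_of_continuousOn
      (f := fun y => σ / (a y : ℂ)) (continuousOn_const.div
        (Complex.continuous_ofReal.comp_continuousOn ha.continuousOn)
        fun y hy => by exact_mod_cast ha0 y hy)
    obtain ⟨M, hM⟩ := (isCompact_Icc.prod isCompact_Icc).exists_bound_of_continuousOn hz.2.1
    have hslice := continuousOn_slice_time hz.2.1 hx'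
    have hnear : ∀ᶠ t in nhds t₀, ‖z t x - z t₀ x‖ < ‖z t₀ x‖ / 2 := by
      have h := (hslice.continuousAt (Icc_mem_nhds ht₀.1 ht₀.2)).eventually
        (Metric.ball_mem_nhds _ (half_pos (norm_pos_iff.2 hne)))
      simpa [dist_eq_norm] using h
    obtain ⟨ε, hε, hball⟩ := Metric.eventually_nhds_iff.1
      (hnear.and (Ioo_mem_nhds ht₀.1 ht₀.2))
    set δ := ε / 2 with hδdef
    have hδ : 0 < δ := half_pos hε
    have hgood : ∀ t ∈ Icc (t₀ - δ) (t₀ + δ),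
        ‖z t x - z t₀ x‖ < ‖z t₀ x‖ / 2 ∧ t ∈ Ioo 0 T := fun t ht =>
      hball (by rw [Real.dist_eq, abs_lt]; constructor <;> linarith [ht.1, ht.2])
    have hα := (hgood (t₀ - δ) ⟨le_rfl, by linarith⟩).2.1
    have hβ := (hgood (t₀ + δ) ⟨by linarith, le_rfl⟩).2.2
    have hαβ : t₀ - δ ≤ t₀ + δ := by linarith
    set K := max K₁ K₂
    have hK : 0 ≤ K := (norm_nonneg _).trans ((hK₁ x hx').trans (le_max_left _ _))
    set R := 4 * K * (1 + 2 * δ) ^ 2 * x ^ 2 with hR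
    have hbound : ∀ N : ℕ, 1 ≤ N →
        ‖z t₀ x‖ / 2 * δ ≤ M * (2 * δ) * ((R / (δ / 2) ^ 2) ^ N / N.factorial) := by
      intro N hN
      have hup := norm_integral_mul_endpointPoly_le hz hpde hcauchy hα hαβ hβ
        (L := 1 + 2 * δ) (M := M) (K := K) (by linarith) (by linarith) hK
        (fun y hy => ha0 y (Ioo_subset_Icc_self hy))
        (fun y hy => (hK₂ y (Ioo_subset_Icc_self hy)).trans (le_max_right _ _))
        (fun y hy => (hK₁ y (Ioo_subset_Icc_self hy)).trans (le_max_left _ _))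
        (fun t ht y hy => hM (t, y) ⟨ht, hy⟩) hN hx
      have hlow := le_norm_integral_mul_of_norm_sub_le hαβ
        (hslice.mono (Icc_subset_Icc hα.le hβ.le))
        (endpointPoly (t₀ - δ) (t₀ + δ) N N).continuous
        (fun t ht => by
          rw [endpointPoly_eval]
          have := sub_nonneg.2 ht.1
          have := sub_nonneg.2 ht.2
          positivity)
        (fun t ht => (hgood t ht).1.le)
      have hmass := mul_le_mul_of_nonneg_left (le_integral_endpointPoly (t₀ := t₀) hδ N)
        (half_pos (norm_pos_iff.2 hne)).le
      have hall := hmass.trans (hlow.trans hup)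
      have hpos : 0 < ((δ / 2) ^ 2) ^ N := by positivity
      rw [div_pow, ← mul_le_mul_iff_of_pos_right hpos]
      calc _ = ‖z t₀ x‖ / 2 * (δ * ((δ / 2) ^ 2) ^ N) := by ring
        _ ≤ _ := hall
        _ = M * (2 * δ) * (R ^ N / N.factorial) := by rw [← hR]; ring
        _ = _ := by
          generalize ((δ / 2) ^ 2) ^ N = w at hpos
          field_simp
    have hlim := (FloorSemiring.tendsto_pow_div_factorial_atTop (R / (δ / 2) ^ 2)).const_mul
      (M * (2 * δ))
    rw [mul_zero] at hlim
    have hle := ge_of_tendsto hlim (Filter.eventually_atTop.2 ⟨1, hbound⟩)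
    have := mul_pos (half_pos (norm_pos_iff.2 hne)) hδ
    linarith
  have hEq : EqOn (fun q : ℝ × ℝ => z q.1 q.2) (fun _ => 0) (Icc 0 T ×ˢ Icc 0 ℓ) :=
    EqOn.of_subset_closure (s := Ioo 0 T ×ˢ Ioo 0 ℓ)
      (fun q hq => hinterior q.1 hq.1 q.2 hq.2) hz.2.1 continuousOn_const
      (prod_mono Ioo_subset_Icc_self Ioo_subset_Icc_self)
      (by rw [closure_prod_eq, closure_Ioo hT.ne, closure_Ioo hℓ.ne])
  exact fun t ht x hx => hEq (mk_mem_prod ht hx)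
end
end
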